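/- Let A_1, …, A_m ∈ M_n be Hermitian matrices and let k ∈ {1, 2, …, ⌊n/2⌋}. The following are equivalent: (a) there is a Hermitian matrix C ∈ M_n with γ(C) = k such that conv W_C(A_1, …, A_m) or W_C(A_1, …, A_m) is polyhedral; (b) there exist an integer ℓ ≥ 2k and a unitary U ∈ M_n such that for each j = 1, …, m, U*A_jU = D_j ⊕ Q_j with D_j ∈ M_ℓ a diagonal matrix, and W_k(A_1, …, A_m) = W_k(D_1, …, D_m); (c) there exist an integer ℓ ≥ 2k and a unitary U ∈ M_n such that for each j, U*A_jU = D_j ⊕ Q_j with D_j ∈ M_ℓ diagonal, and for every Hermitian C ∈ M_n with eigenvalues c_1 ≥ … ≥ c_n and γ(C) = k, one has W_{C − c_{k+1} I}(A_1, …, A_m) = W_{Ĉ}(D_1, …, D_m), where Ĉ = diag(c_1 − c_{k+1}, …, c_k − c_{k+1}, c_{k+n−ℓ+1} − c_{k+1}, …, c_n − c_{k+1}) ∈ M_ℓ; (d) W_C(A_1, …, A_m) is polyhedral for every Hermitian C ∈ M_n with γ(C) ≤ k. -/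

import Mathlib

open Matrix

/-- The joint `C`-numerical range of a tuple of Hermitian matrices, regarded as a
subset of `ℝ^m`. -/
noncomputable def jointCNumRangeR {N m : ℕ} (C : Matrix (Fin N) (Fin N) ℂ)
    (A : Fin m → Matrix (Fin N) (Fin N) ℂ) : Set (Fin m → ℝ) :=
  { p | ∃ U ∈ Matrix.unitaryGroup (Fin N) ℂ,
      ∀ j, (p j : ℂ) = (C * (star U * A j * U)).trace }

/-- The joint `k`-numerical range: the `C`-numerical range with
`C = diag(1, …, 1, 0, …, 0)` having exactly `k` ones. -/
noncomputable def jointKNumRangeR {N m : ℕ} (k : ℕ)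
    (A : Fin m → Matrix (Fin N) (Fin N) ℂ) : Set (Fin m → ℝ) :=
  jointCNumRangeR (Matrix.diagonal fun i : Fin N => if (i : ℕ) < k then (1 : ℂ) else 0) A

/-- A subset of a real vector space is polyhedral if it is the convex hull of a finite set. -/
def IsPolyhedral {E : Type*} [AddCommGroup E] [Module ℝ E] (S : Set E) : Prop :=
  ∃ F : Set E, F.Finite ∧ S = convexHull ℝ F

/-- The eigenvalues of a Hermitian matrix, arranged in descending order
`λ₁(H) ≥ … ≥ λₙ(H)` (junk value `0` if `H` is not Hermitian). -/
noncomputable def eigDesc {N : ℕ} (H : Matrix (Fin N) (Fin N) ℂ) : Fin N → ℝ :=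
  if h : H.IsHermitian then
    fun i => (h.eigenvalues ∘ Tuple.sort h.eigenvalues) i.rev
  else 0

/-- For a Hermitian matrix `C` with eigenvalues `c₁ ≥ … ≥ c_N` (1-based),
`γ(C) = max({j ≤ N/2 : c_j > c_{j+1}} ∪ {N − j ≤ N/2 : c_j > c_{j+1}})`. -/
noncomputable def gammaC {N : ℕ} (C : Matrix (Fin N) (Fin N) ℂ) : ℕ :=
  sSup { t : ℕ | ∃ (j : ℕ) (h1 : 1 ≤ j) (h2 : j < N),
    eigDesc C ⟨j - 1, by omega⟩ > eigDesc C ⟨j, h2⟩ ∧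
    ((t = j ∧ 2 * j ≤ N) ∨ (t = N - j ∧ 2 * (N - j) ≤ N)) }

section Basics

variable {n m : ℕ}

/-- The real diagonal matrix, viewed as a complex matrix. -/
noncomputable def cdiag (c : Fin n → ℝ) : Matrix (Fin n) (Fin n) ℂ :=
  diagonal fun i => (c i : ℂ)

/-- The real number `tr (diag c · U* H U)`. -/
noncomputable def cval (c : Fin n → ℝ) (H U : Matrix (Fin n) (Fin n) ℂ) : ℝ :=
  (cdiag c * (star U * H * U)).trace.re

/-- The real linear combination `∑ j, u j • A j`. -/
noncomputable def comb (A : Fin m → Matrix (Fin n) (Fin n) ℂ) (u : Fin m → ℝ) :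
    Matrix (Fin n) (Fin n) ℂ :=
  ∑ j, (u j : ℂ) • A j

/-- The point of the joint numerical range of `diag c` attached to the unitary `U`. -/
noncomputable def cpoint (c : Fin n → ℝ) (A : Fin m → Matrix (Fin n) (Fin n) ℂ)
    (U : Matrix (Fin n) (Fin n) ℂ) : Fin m → ℝ :=
  fun j => cval c (A j) U

lemma cdiag_isHermitian (c : Fin n → ℝ) : (cdiag c).IsHermitian := by
  rw [cdiag, Matrix.isHermitian_diagonal_iff]
  intro i
  simp [IsSelfAdjoint]

lemma star_mul_mul_isHermitian {H : Matrix (Fin n) (Fin n) ℂ} (hH : H.IsHermitian)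
    (U : Matrix (Fin n) (Fin n) ℂ) : (star U * H * U).IsHermitian :=
  Matrix.isHermitian_conjTranspose_mul_mul U hH

lemma trace_mul_im_eq_zero {C H : Matrix (Fin n) (Fin n) ℂ} (hC : C.IsHermitian)
    (hH : H.IsHermitian) : (C * H).trace.im = 0 := by
  have h : star (C * H).trace = (C * H).trace := by
    rw [← trace_conjTranspose, conjTranspose_mul, hC.eq, hH.eq, trace_mul_comm]
  exact Complex.conj_eq_iff_im.mp h

lemma mem_jointCNumRangeR_cdiag {A : Fin m → Matrix (Fin n) (Fin n) ℂ}
    (hA : ∀ j, (A j).IsHermitian) (c : Fin n → ℝ) (p : Fin m → ℝ) :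
    p ∈ jointCNumRangeR (cdiag c) A ↔ ∃ U ∈ unitaryGroup (Fin n) ℂ, p = cpoint c A U := by
  refine exists_congr fun U => and_congr_right fun _ => ?_
  rw [funext_iff]
  refine forall_congr' fun j => ?_
  have := trace_mul_im_eq_zero (cdiag_isHermitian c) (star_mul_mul_isHermitian (hA j) U)
  rw [Complex.ext_iff]
  simp [this, cpoint, cval]

lemma comb_isHermitian {A : Fin m → Matrix (Fin n) (Fin n) ℂ}
    (hA : ∀ j, (A j).IsHermitian) (u : Fin m → ℝ) : (comb A u).IsHermitian := by
  simp only [Matrix.IsHermitian, comb, conjTranspose_sum, conjTranspose_smul, (hA _).eq]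
  simp

lemma comb_add (A : Fin m → Matrix (Fin n) (Fin n) ℂ) (u v : Fin m → ℝ) :
    comb A (u + v) = comb A u + comb A v := by
  simp [comb, add_smul, Finset.sum_add_distrib]

lemma comb_smul (A : Fin m → Matrix (Fin n) (Fin n) ℂ) (t : ℝ) (v : Fin m → ℝ) :
    comb A (t • v) = (t : ℂ) • comb A v := by
  simp [comb, mul_smul, Finset.smul_sum]

lemma comb_neg (A : Fin m → Matrix (Fin n) (Fin n) ℂ) (v : Fin m → ℝ) :
    comb A (-v) = -comb A v := by
  simp [comb]

lemma comb_single (A : Fin m → Matrix (Fin n) (Fin n) ℂ) (j : Fin m) :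
    comb A (Pi.single j 1) = A j := by
  rw [comb, Finset.sum_eq_single j]
  · simp
  · intro b _ hb
    simp [hb]
  · simp

lemma cval_comb (c : Fin n → ℝ) (A : Fin m → Matrix (Fin n) (Fin n) ℂ) (u : Fin m → ℝ)
    (U : Matrix (Fin n) (Fin n) ℂ) : cval c (comb A u) U = u ⬝ᵥ cpoint c A U := by
  simp [cval, comb, cpoint, dotProduct, Finset.mul_sum, Finset.sum_mul, trace_sum]

lemma cval_add (c d : Fin n → ℝ) (H U : Matrix (Fin n) (Fin n) ℂ) :
    cval (c + d) H U = cval c H U + cval d H U := by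
  have : cdiag (c + d) = cdiag c + cdiag d := by
    simp [cdiag, diagonal_add]
  simp [cval, this, add_mul]

lemma cval_smul (t : ℝ) (c : Fin n → ℝ) (H U : Matrix (Fin n) (Fin n) ℂ) :
    cval (t • c) H U = t * cval c H U := by
  have : cdiag (t • c) = (t : ℂ) • cdiag c := by
    ext i j; by_cases h : i = j <;> simp [cdiag, h]
  simp [cval, this]

lemma cval_conj (c : Fin n → ℝ) (H U W : Matrix (Fin n) (Fin n) ℂ) :
    cval c (W * H * star W) U = cval c H (star W * U) := by
  simp [cval, mul_assoc]

lemma cval_eq_trace (c : Fin n → ℝ) (H U : Matrix (Fin n) (Fin n) ℂ) :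
    cval c H U = (H * (U * cdiag c * star U)).trace.re := by
  rw [cval, trace_mul_comm]
  simp only [mul_assoc]
  rw [trace_mul_comm]
  simp only [mul_assoc]

lemma star_mul_self_of_mem {U : Matrix (Fin n) (Fin n) ℂ} (hU : U ∈ unitaryGroup (Fin n) ℂ) :
    star U * U = 1 := mem_unitaryGroup_iff'.mp hU

lemma mul_star_self_of_mem {U : Matrix (Fin n) (Fin n) ℂ} (hU : U ∈ unitaryGroup (Fin n) ℂ) :
    U * star U = 1 := mem_unitaryGroup_iff.mp hU

lemma star_mem_unitaryGroup {U : Matrix (Fin n) (Fin n) ℂ} (hU : U ∈ unitaryGroup (Fin n) ℂ) :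
    star U ∈ unitaryGroup (Fin n) ℂ := Unitary.star_mem hU

lemma jointCNumRangeR_conj (C : Matrix (Fin n) (Fin n) ℂ) (A : Fin m → Matrix (Fin n) (Fin n) ℂ)
    {V : Matrix (Fin n) (Fin n) ℂ} (hV : V ∈ unitaryGroup (Fin n) ℂ) :
    jointCNumRangeR (V * C * star V) A = jointCNumRangeR C A := by
  ext p
  constructor
  · rintro ⟨U, hU, h⟩
    refine ⟨U * V, mul_mem hU hV, fun j => ?_⟩
    rw [h j, mul_assoc V, mul_assoc V, trace_mul_comm V]
    simp [mul_assoc]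
  · rintro ⟨U, hU, h⟩
    refine ⟨U * star V, mul_mem hU (star_mem_unitaryGroup hV), fun j => ?_⟩
    rw [h j, mul_assoc V, mul_assoc V, trace_mul_comm V]
    have e := star_mul_self_of_mem hV
    have e2 : C * star V * (star (U * star V) * A j * (U * star V)) * V =
      C * (star V * V) * (star U * A j * U) * (star V * V) := by simp [mul_assoc]
    rw [e2, e]; simp

/-- The unitary permutation matrix attached to `σ`. -/
noncomputable def permU (σ : Equiv.Perm (Fin n)) : Matrix (Fin n) (Fin n) ℂ :=
  (1 : Matrix (Fin n) (Fin n) ℂ).submatrix σ id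

lemma permU_mem (σ : Equiv.Perm (Fin n)) : permU σ ∈ unitaryGroup (Fin n) ℂ := by
  rw [mem_unitaryGroup_iff]
  ext i j
  simp [permU, mul_apply, one_apply]

lemma cdiag_comp_perm (c : Fin n → ℝ) (σ : Equiv.Perm (Fin n)) :
    cdiag (c ∘ σ) = permU σ * cdiag c * star (permU σ) := by
  ext i j
  simp only [permU, cdiag, mul_apply, diagonal_apply, submatrix_apply, one_apply, star_apply, id]
  by_cases h : i = j <;> simp [h]

lemma jointCNumRangeR_comp_perm (c : Fin n → ℝ) (A : Fin m → Matrix (Fin n) (Fin n) ℂ)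
    (σ : Equiv.Perm (Fin n)) :
    jointCNumRangeR (cdiag (c ∘ σ)) A = jointCNumRangeR (cdiag c) A := by
  rw [cdiag_comp_perm, jointCNumRangeR_conj _ _ (permU_mem σ)]

lemma exists_perm_antitone (a : Fin n → ℝ) : ∃ σ : Equiv.Perm (Fin n), Antitone (a ∘ σ) := by
  refine ⟨Fin.revPerm.trans (Tuple.sort a), fun i j hij => ?_⟩
  exact Tuple.monotone_sort a (Fin.rev_le_rev.mpr hij)

lemma exists_unitary_diag {H : Matrix (Fin n) (Fin n) ℂ} (hH : H.IsHermitian) :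
    ∃ U ∈ unitaryGroup (Fin n) ℂ, H = U * cdiag hH.eigenvalues * star U := by
  refine ⟨hH.eigenvectorUnitary, hH.eigenvectorUnitary.2, ?_⟩
  have := hH.spectral_theorem
  rw [Unitary.conjStarAlgAut_apply] at this
  exact this

lemma unitary_diag_comp {H U : Matrix (Fin n) (Fin n) ℂ} {a : Fin n → ℝ}
    (hU : U ∈ unitaryGroup (Fin n) ℂ) (h : H = U * cdiag a * star U) (σ : Equiv.Perm (Fin n)) :
    ∃ W ∈ unitaryGroup (Fin n) ℂ, H = W * cdiag (a ∘ σ) * star W := by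
  refine ⟨U * star (permU σ), mul_mem hU (star_mem_unitaryGroup (permU_mem σ)), ?_⟩
  rw [h, cdiag_comp_perm]
  have e := star_mul_self_of_mem (permU_mem σ)
  have : U * star (permU σ) * (permU σ * cdiag a * star (permU σ)) * star (U * star (permU σ))
    = U * (star (permU σ) * permU σ) * cdiag a * (star (permU σ) * permU σ) * star U := by
    simp [mul_assoc]
  rw [this, e]; simp

lemma eigDesc_antitone (H : Matrix (Fin n) (Fin n) ℂ) : Antitone (eigDesc H) := by
  unfold eigDesc
  split_ifs with h
  · exact fun i j hij => Tuple.monotone_sort h.eigenvalues (Fin.rev_le_rev.mpr hij)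
  · exact fun _ _ _ => le_rfl

lemma exists_unitary_eigDesc {H : Matrix (Fin n) (Fin n) ℂ} (hH : H.IsHermitian) :
    ∃ U ∈ unitaryGroup (Fin n) ℂ, H = U * cdiag (eigDesc H) * star U := by
  obtain ⟨U, hU, h⟩ := exists_unitary_diag hH
  have := unitary_diag_comp hU h (Fin.revPerm.trans (Tuple.sort hH.eigenvalues))
  have e : eigDesc H = hH.eigenvalues ∘ (Fin.revPerm.trans (Tuple.sort hH.eigenvalues)) := by
    rw [eigDesc, dif_pos hH]; rfl
  rwa [← e] at this

end Basics

section Doubly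

variable {n m : ℕ}

/-- The matrix of squared moduli of the entries. -/
noncomputable def normSqMat (V : Matrix (Fin n) (Fin n) ℂ) : Matrix (Fin n) (Fin n) ℝ :=
  fun i j => Complex.normSq (V i j)

lemma normSqMat_mem {V : Matrix (Fin n) (Fin n) ℂ} (hV : V ∈ unitaryGroup (Fin n) ℂ) :
    normSqMat V ∈ doublyStochastic ℝ (Fin n) := by
  rw [mem_doublyStochastic_iff_sum]
  refine ⟨fun i j => Complex.normSq_nonneg _, fun i => ?_, fun j => ?_⟩
  · have h := congrFun (congrFun (mul_star_self_of_mem hV) i) i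
    simp only [mul_apply, star_apply, one_apply_eq, RCLike.star_def, Complex.mul_conj] at h
    exact_mod_cast h
  · have h := congrFun (congrFun (star_mul_self_of_mem hV) j) j
    simp only [mul_apply, star_apply, one_apply_eq, RCLike.star_def,
      ← Complex.normSq_eq_conj_mul_self] at h
    exact_mod_cast h

lemma cval_cdiag (c d : Fin n → ℝ) (V : Matrix (Fin n) (Fin n) ℂ) :
    cval c (cdiag d) V = d ⬝ᵥ (normSqMat V *ᵥ c) := by
  rw [cval_eq_trace]
  simp only [trace, diag_apply, cdiag, diagonal_mul, Complex.re_sum, dotProduct, mulVec]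
  refine Finset.sum_congr rfl fun i _ => ?_
  rw [Complex.re_ofReal_mul]
  congr 1
  rw [mul_apply]
  simp only [mul_diagonal, Complex.re_sum, normSqMat, star_apply, RCLike.star_def]
  refine Finset.sum_congr rfl fun j _ => ?_
  rw [mul_right_comm, Complex.mul_conj, ← Complex.ofReal_mul, Complex.ofReal_re]

lemma mulVec_mem_convexHull {M : Matrix (Fin n) (Fin n) ℝ} (hM : M ∈ doublyStochastic ℝ (Fin n))
    (c : Fin n → ℝ) :
    M *ᵥ c ∈ convexHull ℝ (Set.range fun σ : Equiv.Perm (Fin n) => c ∘ σ) := by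
  obtain ⟨w, hw0, hw1, rfl⟩ := exists_eq_sum_perm_of_mem_doublyStochastic hM
  rw [sum_mulVec]
  simp only [smul_mulVec]
  refine (convex_convexHull ℝ _).sum_mem (fun σ _ => hw0 σ) hw1 fun σ _ => ?_
  apply subset_convexHull
  refine ⟨σ, ?_⟩
  ext i
  simp [Matrix.permMatrix_mulVec]

lemma dotProduct_le_of_mem_convexHull {S : Set (Fin m → ℝ)} {x u : Fin m → ℝ} {b : ℝ}
    (hx : x ∈ convexHull ℝ S) (h : ∀ y ∈ S, u ⬝ᵥ y ≤ b) : u ⬝ᵥ x ≤ b := by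
  have hc : Convex ℝ {y : Fin m → ℝ | u ⬝ᵥ y ≤ b} :=
    convex_halfSpace_le ⟨fun x y => dotProduct_add u x y, fun a x => dotProduct_smul a u x⟩ b
  exact convexHull_min (s := S) h hc hx

lemma dotProduct_comp_perm_le {c d : Fin n → ℝ} (hc : Antitone c) (hd : Antitone d)
    (σ : Equiv.Perm (Fin n)) : d ⬝ᵥ (c ∘ σ) ≤ d ⬝ᵥ c :=
  Monovary.sum_mul_comp_perm_le_sum_mul (hd.monovary hc)

lemma cval_le {H W U : Matrix (Fin n) (Fin n) ℂ} {c d : Fin n → ℝ} (hc : Antitone c)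
    (hd : Antitone d) (hW : W ∈ unitaryGroup (Fin n) ℂ) (h : H = W * cdiag d * star W)
    (hU : U ∈ unitaryGroup (Fin n) ℂ) : cval c H U ≤ d ⬝ᵥ c := by
  rw [h, cval_conj, cval_cdiag]
  refine dotProduct_le_of_mem_convexHull
    (mulVec_mem_convexHull (normSqMat_mem (mul_mem (star_mem_unitaryGroup hW) hU)) c) ?_
  rintro _ ⟨σ, rfl⟩
  exact dotProduct_comp_perm_le hc hd σ

lemma cval_eigen {H W : Matrix (Fin n) (Fin n) ℂ} (c : Fin n → ℝ) {d : Fin n → ℝ}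
    (hW : W ∈ unitaryGroup (Fin n) ℂ) (h : H = W * cdiag d * star W) :
    cval c H W = d ⬝ᵥ c := by
  rw [h, cval_conj, cval_cdiag, star_mul_self_of_mem hW]
  congr 1
  ext i
  simp [normSqMat, mulVec, dotProduct, one_apply, apply_ite Complex.normSq]

end Doubly

section Embedding

lemma le_of_comp_injective {l n : ℕ} {f : Fin l → ℝ} {g : Fin n → ℝ} (hf : Antitone f)
    (hg : Antitone g) {e : Fin l → Fin n} (he : Function.Injective e) (hfg : f = g ∘ e)
    (i : Fin l) (j : Fin n) (hij : (j : ℕ) = i) : f i ≤ g j := by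
  obtain ⟨s, hs, hj⟩ : ∃ s ≤ i, j ≤ e s := by
    by_contra! hcon
    have h1 : (Finset.Iic i).card ≤ (Finset.Iio j).card :=
      Finset.card_le_card_of_injOn e
        (fun s hs => by simpa using hcon s (by simpa using hs)) he.injOn
    simp at h1
    omega
  calc f i ≤ f s := hf hs
    _ = g (e s) := by rw [hfg]; rfl
    _ ≤ g j := hg hj

end Embedding

section Horn

variable {n : ℕ}

/-- The indicator of the first `r` indices. -/
def ind (n r : ℕ) : Fin n → ℝ := fun i => if (i : ℕ) < r then 1 else 0

lemma ind_antitone (n r : ℕ) : Antitone (ind n r) := by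
  intro i j hij
  have : (i : ℕ) ≤ j := hij
  unfold ind
  split_ifs <;> first | omega | norm_num

lemma ind_succ_dotProduct (x : Fin n → ℝ) (r : Fin n) :
    ind n (r + 1) ⬝ᵥ x = ind n r ⬝ᵥ x + x r := by
  have : ind n (r + 1) = ind n r + Pi.single r 1 := by
    ext i
    rcases lt_trichotomy i r with h | h | h
    · have : (i : ℕ) < r := h
      simp [ind, h.ne, this, this.trans (Nat.lt_succ_self _)]
    · simp [ind, h]
    · have : (r : ℕ) < i := h
      have h1 : ¬ (i : ℕ) < r := by omega
      have h2 : ¬ (i : ℕ) < r + 1 := by omega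
      simp only [ind, h1, h2, if_false, Pi.add_apply, Pi.single_eq_of_ne h.ne', add_zero]
  rw [this, add_dotProduct, single_one_dotProduct]

lemma ind_zero_dotProduct (x : Fin n → ℝ) : ind n 0 ⬝ᵥ x = 0 := by
  simp [ind, dotProduct]

lemma eq_of_ind_dotProduct_eq {x y : Fin n → ℝ}
    (h : ∀ r ≤ n, ind n r ⬝ᵥ x = ind n r ⬝ᵥ y) : x = y := by
  ext r
  have h1 := h (r + 1) r.2
  have h2 := h r r.2.le
  rw [ind_succ_dotProduct, ind_succ_dotProduct] at h1
  linarith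

/-- A set of vectors stable under all two-coordinate averagings. -/
def AveragingClosed (S : Set (Fin n → ℝ)) : Prop :=
  ∀ y ∈ S, ∀ i j : Fin n, i ≠ j → ∀ t : ℝ, 0 ≤ t → t ≤ 1 → ∀ x : Fin n → ℝ,
    x i = t * y i + (1 - t) * y j → x j = (1 - t) * y i + t * y j →
    (∀ l, l ≠ i → l ≠ j → x l = y l) → x ∈ S

lemma exists_lt_prefix_gap {a x : Fin n → ℝ} (h0 : ∀ r ≤ n, ind n r ⬝ᵥ x ≤ ind n r ⬝ᵥ a)
    (hn : ind n n ⬝ᵥ x = ind n n ⬝ᵥ a) (hne : x ≠ a) :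
    ∃ l h : ℕ, l + 1 < h ∧ h ≤ n ∧ ind n l ⬝ᵥ x = ind n l ⬝ᵥ a ∧ ind n h ⬝ᵥ x = ind n h ⬝ᵥ a ∧
      ∀ r, l < r → r < h → ind n r ⬝ᵥ x < ind n r ⬝ᵥ a := by
  classical
  obtain ⟨r, hr, hrx⟩ : ∃ r ≤ n, ind n r ⬝ᵥ x ≠ ind n r ⬝ᵥ a := by
    by_contra! hcon
    exact hne (eq_of_ind_dotProduct_eq hcon)
  have hrn : r < n := lt_of_le_of_ne hr (by rintro rfl; exact hrx hn)
  have hex : ∃ h, r < h ∧ ind n h ⬝ᵥ x = ind n h ⬝ᵥ a := ⟨n, hrn, hn⟩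
  let T := (Finset.range r).filter fun l => ind n l ⬝ᵥ x = ind n l ⬝ᵥ a
  have hr0 : 0 < r := Nat.pos_of_ne_zero (by rintro rfl; simp [ind_zero_dotProduct] at hrx)
  have hT : T.Nonempty := ⟨0, by simp [T, hr0, ind_zero_dotProduct]⟩
  have hlT := Finset.mem_filter.mp (T.max'_mem hT)
  rw [Finset.mem_range] at hlT
  have hhn : Nat.find hex ≤ n := Nat.find_min' hex ⟨hrn, hn⟩
  have hh := Nat.find_spec hex
  refine ⟨T.max' hT, Nat.find hex, by omega, hhn, hlT.2, hh.2, fun s hs1 hs2 => ?_⟩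
  refine lt_of_le_of_ne (h0 s (by omega)) fun heq => ?_
  rcases lt_trichotomy s r with h | h | h
  · have := T.le_max' s (by simp [T, h, heq])
    omega
  · exact hrx (h ▸ heq)
  · exact Nat.find_min hex hs2 ⟨h, heq⟩

lemma mem_of_majorized {S : Set (Fin n → ℝ)} (hS : AveragingClosed S) {a : Fin n → ℝ}
    (ha : Antitone a) (haS : a ∈ S) (x : Fin n → ℝ) (hx : Antitone x)
    (h0 : ∀ r ≤ n, ind n r ⬝ᵥ x ≤ ind n r ⬝ᵥ a) (hn : ind n n ⬝ᵥ x = ind n n ⬝ᵥ a) : x ∈ S := by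
  classical
  induction hN : ((Finset.range n).filter fun r => ind n r ⬝ᵥ x ≠ ind n r ⬝ᵥ a).card
    using Nat.strong_induction_on generalizing x with
  | _ N ih =>
  by_cases hne : x = a
  · exact hne ▸ haS
  obtain ⟨l, h, hlh, hhn, hl, hh, hgap⟩ := exists_lt_prefix_gap h0 hn hne
  obtain ⟨q, hq, hqmin⟩ := Finset.exists_min_image (Finset.Ioo l h)
    (fun r => ind n r ⬝ᵥ a - ind n r ⬝ᵥ x) ⟨l + 1, by simp; omega⟩
  rw [Finset.mem_Ioo] at hq
  set δ := ind n q ⬝ᵥ a - ind n q ⬝ᵥ x with hδ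
  have hδ0 : 0 < δ := sub_pos.mpr (hgap q hq.1 hq.2)
  let i : Fin n := ⟨l, by omega⟩
  let j : Fin n := ⟨h - 1, by omega⟩
  have hij : i < j := by change l < h - 1; omega
  have hP : ∀ r, ind n r ⬝ᵥ (x + (Pi.single i δ - Pi.single j δ)) =
      ind n r ⬝ᵥ x + if l < r ∧ r < h then δ else 0 := by
    intro r
    rw [dotProduct_add, dotProduct_sub, dotProduct_single, dotProduct_single]
    simp only [ind, i, j]
    congr 1
    split_ifs <;> first | omega | simp
  have hxl : x i + δ ≤ a i := by
    have h1 := hqmin (l + 1) (by simp; omega)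
    have h2 := ind_succ_dotProduct x i
    have h3 := ind_succ_dotProduct a i
    simp only [i] at h2 h3 ⊢
    linarith
  have hxh : a j ≤ x j - δ := by
    have h1 := hqmin (h - 1) (by simp; omega)
    have h2 := ind_succ_dotProduct x j
    have h3 := ind_succ_dotProduct a j
    simp only [j, show h - 1 + 1 = h by omega] at h2 h3 ⊢
    linarith
  have hyi : (x + (Pi.single i δ - Pi.single j δ) : Fin n → ℝ) i = x i + δ := by
    simp [hij.ne]
  have hyj : (x + (Pi.single i δ - Pi.single j δ) : Fin n → ℝ) j = x j - δ := by
    simp [hij.ne', sub_eq_add_neg]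
  have hyo : ∀ s, s ≠ i → s ≠ j → (x + (Pi.single i δ - Pi.single j δ) : Fin n → ℝ) s = x s := by
    intro s h1 h2
    simp [h1, h2]
  have hlow : ∀ s, s < i → x i + δ ≤ x s := by
    intro s hs
    have hs' : (s : ℕ) < l := hs
    let p : Fin n := ⟨l - 1, by omega⟩
    have h1 : x p ≤ x s := hx (show (s : ℕ) ≤ l - 1 by omega)
    have h2 := ind_succ_dotProduct x p
    have h3 := ind_succ_dotProduct a p
    have h4 := h0 (l - 1) (by omega)
    have h5 : a i ≤ a p := ha (show l - 1 ≤ l by omega)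
    simp only [p, show l - 1 + 1 = l by omega] at h1 h2 h3 h5
    linarith
  have hhigh : ∀ s, j < s → x s ≤ x j - δ := by
    intro s hs
    have hs' : h - 1 < (s : ℕ) := hs
    let p : Fin n := ⟨h, by omega⟩
    have h1 : x s ≤ x p := hx (show h ≤ (s : ℕ) by omega)
    have h2 := ind_succ_dotProduct x p
    have h3 := ind_succ_dotProduct a p
    have h4 := h0 (h + 1) (by omega)
    have h5 : a p ≤ a j := ha (show h - 1 ≤ h by omega)
    simp only [p] at h1 h2 h3 h5
    linarith
  generalize x + (Pi.single i δ - Pi.single j δ) = y at *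
  have hyS : y ∈ S := by
    refine ih _ ?_ y ?_ ?_ ?_ rfl
    · rw [← hN]
      apply Finset.card_lt_card
      rw [Finset.ssubset_iff_of_subset]
      · refine ⟨q, by simp; exact ⟨by omega, (hgap q hq.1 hq.2).ne⟩, ?_⟩
        simp [hP, hq, hδ]
      · intro r hr
        simp only [Finset.mem_filter, Finset.mem_range] at hr ⊢
        refine ⟨hr.1, fun heq => hr.2 ?_⟩
        rw [hP, if_neg, add_zero, heq]
        rintro ⟨h1, h2⟩
        exact (hgap r h1 h2).ne heq
    · intro s t hst
      rcases hst.eq_or_lt with rfl | hst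
      · exact le_rfl
      have hst' := hx hst.le
      have key : ∀ w, y w = if w = i then x i + δ else if w = j then x j - δ else x w := by
        intro w
        split_ifs with h1 h2
        · rw [h1, hyi]
        · rw [h2, hyj]
        · exact hyo w h1 h2
      rw [key s, key t]
      by_cases si : s = i
      · subst si
        rw [if_pos rfl, if_neg hst.ne']
        split_ifs with tj
        · rw [tj] at hst'
          linarith
        · linarith
      by_cases ti : t = i
      · subst ti
        have := hlow s hst
        rw [if_pos rfl, if_neg si, if_neg (hst.trans hij).ne]
        exact this
      rw [if_neg si, if_neg ti]
      by_cases sj : s = j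
      · subst sj
        rw [if_neg hst.ne', if_pos rfl]
        exact hhigh t hst
      rw [if_neg sj]
      split_ifs with tj
      · subst tj
        linarith
      · exact hst'
    · intro r hr
      rw [hP]
      split_ifs with h1
      · have := hqmin r (by simpa using h1)
        linarith
      · simpa using h0 r hr
    · rw [hP, if_neg (by omega), add_zero, hn]
  have hxij : x j ≤ x i := hx hij.le
  have hd : (x i + δ) - (x j - δ) ≠ 0 := by linarith
  refine hS y hyS i j hij.ne ((x i - (x j - δ)) / ((x i + δ) - (x j - δ))) ?_ ?_ x ?_ ?_ ?_
  · exact div_nonneg (by linarith) (by linarith)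
  · rw [div_le_one (by linarith)]; linarith
  · rw [hyi, hyj]; field_simp; ring
  · rw [hyi, hyj]; field_simp; ring
  · intro s h1 h2
    exact (hyo s h1 h2).symm

end Horn

section SchurHorn

variable {n m : ℕ}

/-- The matrix obtained from `U` by rotating its rows `i` and `j`. -/
noncomputable def rotRows (U : Matrix (Fin n) (Fin n) ℂ) (i j : Fin n) (s r : ℝ) (ω : ℂ) :
    Matrix (Fin n) (Fin n) ℂ :=
  (U.updateRow i ((s : ℂ) • U i + ((r : ℂ) * ω) • U j)).updateRow j
    (-((r : ℂ) * star ω) • U i + (s : ℂ) • U j)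

lemma rotRows_mem {U : Matrix (Fin n) (Fin n) ℂ} (hU : U ∈ unitaryGroup (Fin n) ℂ)
    {i j : Fin n} (hij : i ≠ j) {s r : ℝ} {ω : ℂ} (hsr : s ^ 2 + r ^ 2 = 1)
    (hω : ω * star ω = 1) : rotRows U i j s r ω ∈ unitaryGroup (Fin n) ℂ := by
  have hsr' : (s : ℂ) ^ 2 + (r : ℂ) ^ 2 = 1 := by exact_mod_cast hsr
  replace hω : ω * (starRingEnd ℂ) ω = 1 := hω
  have hg : ∀ a b, U a ⬝ᵥ star (U b) = if a = b then 1 else 0 := fun a b => by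
    have h := congrFun (congrFun (mul_star_self_of_mem hU) a) b
    rw [mul_apply, one_apply] at h
    exact h
  have hi : rotRows U i j s r ω i = (s : ℂ) • U i + ((r : ℂ) * ω) • U j := by
    rw [rotRows, updateRow_ne hij, updateRow_self]
  have hj : rotRows U i j s r ω j = -((r : ℂ) * star ω) • U i + (s : ℂ) • U j := by
    rw [rotRows, updateRow_self]
  have ho : ∀ a, a ≠ i → a ≠ j → rotRows U i j s r ω a = U a := fun a h1 h2 => by
    rw [rotRows, updateRow_ne h2, updateRow_ne h1]
  rw [mem_unitaryGroup_iff]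
  ext a b
  rw [mul_apply, one_apply]
  change rotRows U i j s r ω a ⬝ᵥ star (rotRows U i j s r ω b) = _
  have hij' := hij.symm
  by_cases ai : a = i
  · by_cases bi : b = i
    · simp [ai, bi, hi, hg, hij, hij']
      linear_combination hsr' + (r : ℂ) ^ 2 * hω
    · by_cases bj : b = j
      · simp [ai, bj, hi, hj, hg, hij, hij']
        ring
      · simp [ai, ho b bi bj, hi, hg, Ne.symm bi, Ne.symm bj]
  · by_cases aj : a = j
    · by_cases bi : b = i
      · simp [aj, bi, hi, hj, hg, hij, hij']
        ring
      · by_cases bj : b = j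
        · simp [aj, bj, hj, hg, hij, hij']
          linear_combination hsr' + (r : ℂ) ^ 2 * hω
        · simp [aj, ho b bi bj, hj, hg, Ne.symm bi, Ne.symm bj]
    · by_cases bi : b = i
      · simp [bi, ho a ai aj, hi, hg, ai, aj]
      · by_cases bj : b = j
        · simp [bj, ho a ai aj, hj, hg, ai, aj]
        · simp [ho a ai aj, ho b bi bj, hg]

lemma sum_normSq_comb (a b : Fin n → ℂ) (c : Fin n → ℝ) (s : ℝ) (ζ : ℂ) :
    ∑ l, Complex.normSq (s * a l + ζ * b l) * c l =
      s ^ 2 * ∑ l, Complex.normSq (a l) * c l + Complex.normSq ζ * ∑ l, Complex.normSq (b l) * c l +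
        2 * s * (star ζ * ∑ l, a l * star (b l) * (c l : ℂ)).re := by
  rw [Finset.mul_sum, Finset.mul_sum, Finset.mul_sum, Complex.re_sum, Finset.mul_sum,
    ← Finset.sum_add_distrib, ← Finset.sum_add_distrib]
  refine Finset.sum_congr rfl fun l _ => ?_
  simp [Complex.normSq_apply]
  ring

lemma exists_unit_re_eq_zero (z : ℂ) : ∃ ω : ℂ, ω * star ω = 1 ∧ (star ω * z).re = 0 := by
  by_cases hz : z = 0
  · exact ⟨1, by simp [hz]⟩
  · have hn : (‖z‖ : ℂ) ≠ 0 := by simpa using hz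
    have hzz : z * star z = (‖z‖ : ℂ) ^ 2 := Complex.mul_conj' z
    refine ⟨Complex.I * z / ‖z‖, ?_, ?_⟩
    · simp only [star_div₀, star_mul', RCLike.star_def, Complex.conj_I, Complex.conj_ofReal] at hzz ⊢
      field_simp
      linear_combination -Complex.I ^ 2 * hzz - (‖z‖ : ℂ) ^ 2 * Complex.I_sq
    · have : star (Complex.I * z / ‖z‖) * z = -Complex.I * ((‖z‖ : ℝ) : ℂ) := by
        simp only [star_div₀, star_mul', RCLike.star_def, Complex.conj_I,
          Complex.conj_ofReal] at hzz ⊢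
        field_simp
        linear_combination -hzz
      rw [this]
      simp

lemma averagingClosed_normSqMat (c : Fin n → ℝ) :
    AveragingClosed {x | ∃ U ∈ unitaryGroup (Fin n) ℂ, x = normSqMat U *ᵥ c} := by
  rintro _ ⟨U, hU, rfl⟩ i j hij t ht0 ht1 x hi hj ho
  obtain ⟨ω, hω, hz⟩ := exists_unit_re_eq_zero (∑ l, U i l * star (U j l) * (c l : ℂ))
  have hω' : Complex.normSq ω = 1 := by
    have : ω * star ω = Complex.normSq ω := Complex.mul_conj ω
    rw [hω] at this
    exact_mod_cast this.symm
  have hs : √t ^ 2 = t := Real.sq_sqrt ht0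
  have hr : √(1 - t) ^ 2 = 1 - t := Real.sq_sqrt (by linarith)
  refine ⟨rotRows U i j √t √(1 - t) ω, rotRows_mem hU hij (by rw [hs, hr]; ring) hω, ?_⟩
  ext a
  by_cases aj : a = j
  · subst aj
    rw [hj]
    simp only [mulVec, dotProduct, normSqMat, rotRows, updateRow_self, Pi.add_apply, Pi.smul_apply,
      smul_eq_mul]
    simp only [add_comm _ ((√t : ℂ) * _)]
    rw [sum_normSq_comb]
    have : (star (-((√(1 - t) : ℂ) * star ω)) * ∑ l, U a l * star (U i l) * (c l : ℂ)).re = 0 := by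
      have h2 : star (-((√(1 - t) : ℂ) * star ω)) * ∑ l, U a l * star (U i l) * (c l : ℂ) =
          ((-√(1 - t) : ℝ) : ℂ) * star (star ω * ∑ l, U i l * star (U a l) * (c l : ℂ)) := by
        simp [Finset.mul_sum]
        refine Finset.sum_congr rfl fun l _ => ?_
        ring
      rw [h2, Complex.re_ofReal_mul, Complex.star_def, Complex.conj_re]
      exact mul_eq_zero_of_right _ hz
    rw [this, hs, Complex.normSq_neg, Complex.normSq_mul, Complex.star_def, Complex.normSq_conj,
      hω', Complex.normSq_ofReal, ← sq, hr]
    ring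
  by_cases ai : a = i
  · subst ai
    rw [hi]
    simp only [mulVec, dotProduct, normSqMat, rotRows, updateRow_self, Pi.add_apply, Pi.smul_apply,
      smul_eq_mul, updateRow_ne hij]
    rw [sum_normSq_comb]
    have : (star ((√(1 - t) : ℂ) * ω) * ∑ l, U a l * star (U j l) * (c l : ℂ)).re = 0 := by
      have h2 : star ((√(1 - t) : ℂ) * ω) = ((√(1 - t) : ℝ) : ℂ) * star ω := by simp
      rw [h2, mul_assoc, Complex.re_ofReal_mul, hz, mul_zero]
    rw [this, hs, Complex.normSq_mul, hω', Complex.normSq_ofReal, ← sq, hr]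
    ring
  · rw [ho a ai aj]
    simp only [mulVec, dotProduct, normSqMat, rotRows, updateRow_ne aj, updateRow_ne ai]

/-- **Horn's theorem**: every vector in the convex hull of the permutations of `c` is the diagonal
of a Hermitian matrix with eigenvalues `c`. -/
lemma exists_unitary_of_mem_convexHull {c : Fin n → ℝ} (hc : Antitone c) {x : Fin n → ℝ}
    (hx : x ∈ convexHull ℝ (Set.range fun σ : Equiv.Perm (Fin n) => c ∘ σ)) :
    ∃ U ∈ unitaryGroup (Fin n) ℂ, x = normSqMat U *ᵥ c := by
  obtain ⟨τ, hτ⟩ := exists_perm_antitone x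
  have hcS : c ∈ {x | ∃ U ∈ unitaryGroup (Fin n) ℂ, x = normSqMat U *ᵥ c} :=
    ⟨1, one_mem _, by
      ext i
      simp [normSqMat, mulVec, dotProduct, one_apply, apply_ite Complex.normSq]⟩
  have hdot : ∀ d : Fin n → ℝ, d ⬝ᵥ (x ∘ τ) = (d ∘ τ.symm) ⬝ᵥ x := fun d =>
    (comp_equiv_symm_dotProduct _ _ _).symm
  have hperm : ∀ (d : Fin n → ℝ) (σ : Equiv.Perm (Fin n)),
      (d ∘ τ.symm) ⬝ᵥ (c ∘ σ) = d ⬝ᵥ (c ∘ (σ * τ : Equiv.Perm (Fin n))) := fun d σ => by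
    rw [comp_equiv_symm_dotProduct]
    rfl
  have hle : ∀ d : Fin n → ℝ, Antitone d → d ⬝ᵥ (x ∘ τ) ≤ d ⬝ᵥ c := fun d hd => by
    rw [hdot]
    refine dotProduct_le_of_mem_convexHull hx ?_
    rintro _ ⟨σ, rfl⟩
    rw [hperm]
    exact dotProduct_comp_perm_le hc hd _
  obtain ⟨U, hU, hxU⟩ := mem_of_majorized (averagingClosed_normSqMat c) hc hcS (x ∘ τ) hτ
    (fun r _ => hle _ (ind_antitone n r)) (le_antisymm (hle _ (ind_antitone n n)) (by
      have := hle (-ind n n) (by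
        intro a b _
        simp [ind])
      simpa using this))
  refine ⟨U.submatrix τ.symm id, ?_, ?_⟩
  · rw [mem_unitaryGroup_iff, star_eq_conjTranspose, conjTranspose_submatrix,
      ← submatrix_mul U Uᴴ τ.symm id τ.symm Function.bijective_id, ← star_eq_conjTranspose, mul_star_self_of_mem hU, submatrix_one_equiv]
  · ext i
    have := congrFun hxU (τ.symm i)
    simpa [mulVec, normSqMat] using this

lemma jointCNumRangeR_diag_eq {c : Fin n → ℝ} (hc : Antitone c) (d : Fin m → Fin n → ℝ) :
    jointCNumRangeR (cdiag c) (fun j => cdiag (d j)) =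
      convexHull ℝ (Set.range fun σ : Equiv.Perm (Fin n) => fun j => d j ⬝ᵥ (c ∘ σ)) := by
  let L : (Fin n → ℝ) →ₗ[ℝ] (Fin m → ℝ) := Matrix.mulVecLin (Matrix.of d)
  have hL : ∀ x, L x = fun j => d j ⬝ᵥ x := fun x => rfl
  have : (Set.range fun σ : Equiv.Perm (Fin n) => fun j => d j ⬝ᵥ (c ∘ σ)) =
      L '' (Set.range fun σ : Equiv.Perm (Fin n) => c ∘ σ) := by
    rw [← Set.range_comp]
    rfl
  rw [this, ← LinearMap.image_convexHull]
  ext p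
  rw [mem_jointCNumRangeR_cdiag (fun j => cdiag_isHermitian _)]
  constructor
  · rintro ⟨U, hU, rfl⟩
    refine ⟨normSqMat U *ᵥ c, mulVec_mem_convexHull (normSqMat_mem hU) c, ?_⟩
    ext j
    exact (cval_cdiag c (d j) U).symm
  · rintro ⟨x, hx, rfl⟩
    obtain ⟨U, hU, rfl⟩ := exists_unitary_of_mem_convexHull hc hx
    refine ⟨U, hU, ?_⟩
    ext j
    exact (cval_cdiag c (d j) U).symm

lemma isPolyhedral_diag {c : Fin n → ℝ} (hc : Antitone c) (d : Fin m → Fin n → ℝ) :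
    IsPolyhedral (jointCNumRangeR (cdiag c) (fun j => cdiag (d j))) :=
  ⟨_, Set.finite_range _, jointCNumRangeR_diag_eq hc d⟩

end SchurHorn

section Polyhedral

variable {m : ℕ}

lemma IsPolyhedral.convex {S : Set (Fin m → ℝ)} (h : IsPolyhedral S) : Convex ℝ S := by
  obtain ⟨F, _, rfl⟩ := h
  exact convex_convexHull ℝ F

lemma IsPolyhedral.isClosed {S : Set (Fin m → ℝ)} (h : IsPolyhedral S) : IsClosed S := by
  obtain ⟨F, hF, rfl⟩ := h
  exact hF.isClosed_convexHull ℝ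

lemma exists_dotProduct_eq (f : StrongDual ℝ (Fin m → ℝ)) :
    ∃ u : Fin m → ℝ, ∀ x, f x = u ⬝ᵥ x := by
  refine ⟨fun j => f (Pi.single j 1), fun x => ?_⟩
  conv_lhs => rw [pi_eq_sum_univ' x]
  simp [map_sum, dotProduct, mul_comm, Pi.single]

/-- A closed convex set contains every point dominated, in each direction, by one of its points. -/
lemma IsPolyhedral.mem_of_forall {S : Set (Fin m → ℝ)} (h : IsPolyhedral S) {p : Fin m → ℝ}
    (hp : ∀ u : Fin m → ℝ, ∃ q ∈ S, u ⬝ᵥ p ≤ u ⬝ᵥ q) : p ∈ S := by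
  by_contra hpS
  obtain ⟨f, b, hlt, hb⟩ := geometric_hahn_banach_closed_point h.convex h.isClosed hpS
  obtain ⟨u, hu⟩ := exists_dotProduct_eq f
  obtain ⟨q, hq, hle⟩ := hp u
  have := hlt q hq
  rw [hu] at this hb
  linarith

lemma IsPolyhedral.image_neg {S : Set (Fin m → ℝ)} (h : IsPolyhedral S) :
    IsPolyhedral (-S) := by
  obtain ⟨F, hF, rfl⟩ := h
  exact ⟨-F, hF.neg, (convexHull_neg F).symm⟩

end Polyhedral

section DiagonalConjugation

open scoped ComplexOrder

variable {n : ℕ}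

/-- The Hermitian matrix with eigenvalues `a` and eigenvectors the columns of `W`. -/
noncomputable def dconj (W : Matrix (Fin n) (Fin n) ℂ) (a : Fin n → ℝ) :
    Matrix (Fin n) (Fin n) ℂ :=
  W * cdiag a * star W

lemma cdiag_mul (a b : Fin n → ℝ) : cdiag a * cdiag b = cdiag (a * b) := by
  simp [cdiag]

lemma cdiag_sub (a b : Fin n → ℝ) : cdiag (a - b) = cdiag a - cdiag b := by
  simp [cdiag]

lemma cdiag_const (t : ℝ) : cdiag (fun _ : Fin n => t) = (t : ℂ) • 1 := by
  simp [cdiag, smul_one_eq_diagonal]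

lemma dconj_mul {W : Matrix (Fin n) (Fin n) ℂ} (hW : W ∈ unitaryGroup (Fin n) ℂ)
    (a b : Fin n → ℝ) : dconj W a * dconj W b = dconj W (a * b) := by
  have h := star_mul_self_of_mem hW
  calc W * cdiag a * star W * (W * cdiag b * star W)
      = W * cdiag a * (star W * W) * cdiag b * star W := by noncomm_ring
    _ = dconj W (a * b) := by rw [h, mul_one, mul_assoc W, cdiag_mul, dconj]

lemma dconj_sub (W : Matrix (Fin n) (Fin n) ℂ) (a b : Fin n → ℝ) :
    dconj W (a - b) = dconj W a - dconj W b := by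
  rw [dconj, cdiag_sub, mul_sub, sub_mul, dconj, dconj]

lemma dconj_const {W : Matrix (Fin n) (Fin n) ℂ} (hW : W ∈ unitaryGroup (Fin n) ℂ) (t : ℝ) :
    dconj W (fun _ => t) = (t : ℂ) • 1 := by
  rw [dconj, cdiag_const, mul_smul_comm, mul_one, smul_mul_assoc, mul_star_self_of_mem hW]

lemma dconj_isHermitian (W : Matrix (Fin n) (Fin n) ℂ) (a : Fin n → ℝ) :
    (dconj W a).IsHermitian :=
  isHermitian_mul_mul_conjTranspose W (cdiag_isHermitian a)

lemma trace_dconj {W : Matrix (Fin n) (Fin n) ℂ} (hW : W ∈ unitaryGroup (Fin n) ℂ)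
    (a : Fin n → ℝ) : (dconj W a).trace = ((∑ i, a i : ℝ) : ℂ) := by
  rw [dconj, trace_mul_comm, ← mul_assoc, star_mul_self_of_mem hW, one_mul]
  simp [cdiag, trace]

lemma dconj_posSemidef (W : Matrix (Fin n) (Fin n) ℂ) {a : Fin n → ℝ} (ha : ∀ i, 0 ≤ a i) :
    (dconj W a).PosSemidef := by
  refine PosSemidef.mul_mul_conjTranspose_same (PosSemidef.diagonal fun i => ?_) W
  exact Complex.zero_le_real.mpr (ha i)

lemma ind_mul_self (n r : ℕ) : ind n r * ind n r = ind n r := by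
  ext i
  simp [ind]

/-- The orthogonal projector onto the span of the first `k` columns of `U`. -/
noncomputable def proj (k : ℕ) (U : Matrix (Fin n) (Fin n) ℂ) : Matrix (Fin n) (Fin n) ℂ :=
  dconj U (ind n k)

lemma proj_isHermitian (k : ℕ) (U : Matrix (Fin n) (Fin n) ℂ) : (proj k U).IsHermitian :=
  dconj_isHermitian _ _

lemma proj_mul_self (k : ℕ) {U : Matrix (Fin n) (Fin n) ℂ} (hU : U ∈ unitaryGroup (Fin n) ℂ) :
    proj k U * proj k U = proj k U := by
  rw [proj, dconj_mul hU, ind_mul_self]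

end DiagonalConjugation

section PosSemidef

open scoped ComplexOrder

variable {n : ℕ}

lemma mul_eq_zero_of_conj_eq_zero {N P : Matrix (Fin n) (Fin n) ℂ} (hN : N.PosSemidef)
    (h : Pᴴ * N * P = 0) : N * P = 0 := by
  apply Matrix.ext_of_mulVec_single
  intro i
  rw [zero_mulVec, ← mulVec_mulVec]
  apply (hN.dotProduct_mulVec_zero_iff _).mp
  rw [star_mulVec, ← dotProduct_mulVec, mulVec_mulVec, mulVec_mulVec, h]
  simp

lemma nonneg_of_ofReal_mul_nonneg {t : ℝ} {z : ℂ} (hz : 0 < z) (h : 0 ≤ (t : ℂ) * z) : 0 ≤ t := by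
  have h1 := (Complex.nonneg_iff.mp h).1
  rw [Complex.re_ofReal_mul] at h1
  exact nonneg_of_mul_nonneg_left h1 (Complex.pos_iff.mp hz).1

lemma trace_mul_proj_nonneg {N P : Matrix (Fin n) (Fin n) ℂ} (hN : N.PosSemidef)
    (hP : P.IsHermitian) (hPP : P * P = P) : 0 ≤ (N * P).trace := by
  have h : (N * P).trace = (Pᴴ * N * P).trace := by
    rw [hP.eq, mul_assoc, trace_mul_comm P (N * P), mul_assoc, hPP]
  rw [h]
  exact (hN.conjTranspose_mul_mul_same P).trace_nonneg

lemma mul_proj_eq_zero {N P : Matrix (Fin n) (Fin n) ℂ} (hN : N.PosSemidef)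
    (hP : P.IsHermitian) (hPP : P * P = P) (h0 : (N * P).trace = 0) : N * P = 0 := by
  apply mul_eq_zero_of_conj_eq_zero hN
  rw [← (hN.conjTranspose_mul_mul_same P).trace_eq_zero_iff, hP.eq, mul_assoc, trace_mul_comm P (N * P),
    mul_assoc, hPP, h0]

end PosSemidef

section Top

open scoped ComplexOrder

variable {n : ℕ}

/-- The unitary `U` maximizes `tr (diag c · U* H U)`. -/
def IsMaximizer (c : Fin n → ℝ) (H U : Matrix (Fin n) (Fin n) ℂ) : Prop :=
  U ∈ unitaryGroup (Fin n) ℂ ∧ ∀ V ∈ unitaryGroup (Fin n) ℂ, cval c H V ≤ cval c H U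

lemma IsMaximizer.cval_eq {c d : Fin n → ℝ} {H U W : Matrix (Fin n) (Fin n) ℂ}
    (h : IsMaximizer c H U) (hc : Antitone c) (hd : Antitone d)
    (hW : W ∈ unitaryGroup (Fin n) ℂ) (hH : H = dconj W d) : cval c H U = d ⬝ᵥ c :=
  le_antisymm (cval_le hc hd hW hH h.1) (cval_eigen c hW hH ▸ h.2 W hW)

lemma IsMaximizer.ind {c : Fin n → ℝ} {H U : Matrix (Fin n) (Fin n) ℂ}
    (h : IsMaximizer c H U) (hH : H.IsHermitian) (hc : Antitone c) {k : ℕ} (hk1 : 1 ≤ k)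
    (hkn : k < n) (hck : c ⟨k, hkn⟩ < c ⟨k - 1, by omega⟩) : IsMaximizer (ind n k) H U := by
  obtain ⟨W, hW, hHW⟩ := exists_unitary_eigDesc hH
  have hd := eigDesc_antitone H
  set ε := c ⟨k - 1, by omega⟩ - c ⟨k, hkn⟩ with hε
  have hε0 : 0 < ε := sub_pos.mpr hck
  have hc' : Antitone (c - ε • _root_.ind n k) := by
    intro i j hij
    have hij' : (i : ℕ) ≤ j := hij
    have h1 := hc hij
    simp only [Pi.sub_apply, Pi.smul_apply, smul_eq_mul, _root_.ind]
    split_ifs with hj hi hi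
    · linarith
    · omega
    · have h2 : c ⟨k - 1, by omega⟩ ≤ c i := hc (show (i : ℕ) ≤ k - 1 by omega)
      have h3 : c j ≤ c ⟨k, hkn⟩ := hc (show k ≤ (j : ℕ) by omega)
      linarith
    · linarith
  have hsum : c = (c - ε • _root_.ind n k) + ε • _root_.ind n k := by abel
  have key : ∀ V, cval c H V = cval (c - ε • _root_.ind n k) H V + ε * cval (_root_.ind n k) H V :=
    fun V => by rw [← cval_smul, ← cval_add, ← hsum]
  refine ⟨h.1, fun V hV => ?_⟩
  have h1 := cval_le (ind_antitone n k) hd hW hHW hV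
  have h2 := h.2 W hW
  rw [key, key] at h2
  have h3 := cval_le hc' hd hW hHW h.1
  rw [← cval_eigen _ hW hHW] at h1 h3
  have h4 : ε * cval (_root_.ind n k) H W ≤ ε * cval (_root_.ind n k) H U := by linarith
  exact h1.trans (le_of_mul_le_mul_left h4 hε0)

/-- The spectral description of all the maximizers of `tr (P H)` over the projectors of rank `k`. -/
lemma exists_threshold {H : Matrix (Fin n) (Fin n) ℂ} (hH : H.IsHermitian) {k : ℕ} (hk1 : 1 ≤ k)
    (hkn : k ≤ n) : ∃ (τ : ℝ) (G : Matrix (Fin n) (Fin n) ℂ), G.PosSemidef ∧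
      (G - (H - (τ : ℂ) • 1)).PosSemidef ∧ ∀ U, IsMaximizer (ind n k) H U →
        (H - (τ : ℂ) • 1) * proj k U = G ∧ G * proj k U = G := by
  obtain ⟨W, hW, hHW⟩ := exists_unitary_eigDesc hH
  have hd := eigDesc_antitone H
  generalize eigDesc H = d at hHW hd
  set τ := d ⟨k - 1, by omega⟩ with hτ
  have hHτ : H - (τ : ℂ) • 1 = dconj W (d - fun _ => τ) := by
    rw [dconj_sub, dconj_const hW, hHW, dconj]
  have hG : (dconj W ((d - fun _ => τ) * ind n k)).PosSemidef := by
    refine dconj_posSemidef W fun i => ?_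
    simp only [Pi.mul_apply, Pi.sub_apply, ind]
    split_ifs with hi
    · have : τ ≤ d i := hd (show (i : ℕ) ≤ k - 1 by omega)
      linarith
    · simp
  have hN : (dconj W ((d - fun _ => τ) * ind n k) - (H - (τ : ℂ) • 1)).PosSemidef := by
    rw [hHτ, ← dconj_sub]
    refine dconj_posSemidef W fun i => ?_
    simp only [Pi.mul_apply, Pi.sub_apply, ind]
    split_ifs with hi
    · simp
    · have : d i ≤ τ := hd (show k - 1 ≤ (i : ℕ) by omega)
      linarith
  refine ⟨τ, _, hG, hN, fun U hU => ?_⟩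
  set G := dconj W ((d - fun _ => τ) * ind n k) with hGdef
  set P := proj k U with hP
  have hPh : P.IsHermitian := proj_isHermitian k U
  have hPP : P * P = P := proj_mul_self k hU.1
  have htr : ((H - (τ : ℂ) • 1) * P).trace = G.trace := by
    have h1 : (H * P).trace.re = d ⬝ᵥ ind n k := by
      rw [← hU.cval_eq (ind_antitone n k) hd hW hHW, cval_eq_trace]
      rfl
    have h2 : (H * P).trace = ((d ⬝ᵥ ind n k : ℝ) : ℂ) :=
      Complex.ext h1 (by simpa using trace_mul_im_eq_zero hH hPh)
    rw [sub_mul, trace_sub, h2, smul_mul_assoc, one_mul, trace_smul, hP, proj, trace_dconj hU.1,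
      hGdef, trace_dconj hW]
    simp only [Pi.mul_apply, Pi.sub_apply, sub_mul, Finset.sum_sub_distrib, ← Finset.mul_sum,
      dotProduct]
    push_cast
    rfl
  have hQh : (1 - P).IsHermitian := isHermitian_one.sub hPh
  have hQQ : (1 - P) * (1 - P) = 1 - P := by
    rw [mul_sub, sub_mul, sub_mul, hPP]
    simp
  have e1 := trace_mul_proj_nonneg hG hQh hQQ
  have e2 := trace_mul_proj_nonneg hN hPh hPP
  have e3 : (G * (1 - P)).trace + ((G - (H - (τ : ℂ) • 1)) * P).trace = 0 := by
    rw [mul_sub, sub_mul, trace_sub, trace_sub, htr, mul_one]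
    ring
  obtain ⟨e4, e5⟩ := (add_eq_zero_iff_of_nonneg e1 e2).mp e3
  have e6 := mul_proj_eq_zero hG hQh hQQ e4
  have e7 := mul_proj_eq_zero hN hPh hPP e5
  rw [mul_sub, mul_one, sub_eq_zero] at e6
  rw [sub_mul, sub_eq_zero] at e7
  exact ⟨e7.symm.trans e6.symm, e6.symm⟩

lemma IsMaximizer.commute_proj {H U : Matrix (Fin n) (Fin n) ℂ} {k : ℕ}
    (h : IsMaximizer (_root_.ind n k) H U) (hH : H.IsHermitian) (hk1 : 1 ≤ k) (hkn : k ≤ n) :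
    Commute H (proj k U) := by
  obtain ⟨τ, G, hG, -, hU⟩ := exists_threshold hH hk1 hkn
  have h1 := (hU U h).1
  have h2 := congrArg conjTranspose h1
  rw [conjTranspose_mul, hG.1.eq, (proj_isHermitian k U).eq, conjTranspose_sub, hH.eq,
    conjTranspose_smul, conjTranspose_one] at h2
  have h3 := h1.trans h2.symm
  simpa [sub_mul, mul_sub, Commute, SemiconjBy] using h3

lemma IsMaximizer.exists_mul_proj_sub {H U V : Matrix (Fin n) (Fin n) ℂ} {k : ℕ}
    (hU : IsMaximizer (_root_.ind n k) H U) (hV : IsMaximizer (_root_.ind n k) H V)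
    (hH : H.IsHermitian) (hk1 : 1 ≤ k) (hkn : k ≤ n) :
    ∃ τ : ℝ, H * (proj k U - proj k V) = (τ : ℂ) • (proj k U - proj k V) := by
  obtain ⟨τ, G, -, -, h⟩ := exists_threshold hH hk1 hkn
  refine ⟨τ, ?_⟩
  have h1 := (h U hU).1.trans (h V hV).1.symm
  rw [sub_mul, sub_mul, smul_mul_assoc, smul_mul_assoc, one_mul, one_mul] at h1
  rw [mul_sub, smul_sub, sub_eq_sub_iff_sub_eq_sub]
  exact h1

/-- Let `U` and `V` give the top and the bottom eigenspaces of `H`. If these meet, then `H` is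
scalar on the intersection of the orthogonal complements, and vice versa. -/
lemma IsMaximizer.exists_scalar {H U V : Matrix (Fin n) (Fin n) ℂ} {k : ℕ}
    (hU : IsMaximizer (_root_.ind n k) H U) (hV : IsMaximizer (_root_.ind n k) (-H) V)
    (hH : H.IsHermitian) (hk1 : 1 ≤ k) (hkn : k ≤ n) :
    ∃ τ : ℂ, ∀ x y : Fin n → ℂ, x ≠ 0 → y ≠ 0 → proj k U *ᵥ x = x → proj k V *ᵥ x = x →
      proj k U *ᵥ y = 0 → proj k V *ᵥ y = 0 → H *ᵥ x = τ • x ∧ H *ᵥ y = τ • y := by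
  obtain ⟨τ, G, hG, hN, h⟩ := exists_threshold hH hk1 hkn
  obtain ⟨σ, G', hG', hN', h'⟩ := exists_threshold hH.neg hk1 hkn
  obtain ⟨h1, h2⟩ := h U hU
  obtain ⟨h1', h2'⟩ := h' V hV
  refine ⟨τ, fun x y hx hy hxU hxV hyU hyV => ?_⟩
  have a1 : G *ᵥ x = H *ᵥ x - (τ : ℂ) • x := by
    rw [← h1, ← mulVec_mulVec, hxU, sub_mulVec, smul_mulVec, one_mulVec]
  have a2 : G' *ᵥ x = -(H *ᵥ x) - (σ : ℂ) • x := by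
    rw [← h1', ← mulVec_mulVec, hxV, sub_mulVec, smul_mulVec, one_mulVec, neg_mulVec]
  have b1 : (G - (H - (τ : ℂ) • 1)) *ᵥ y = -(H *ᵥ y) + (τ : ℂ) • y := by
    rw [sub_mulVec, ← h2, ← mulVec_mulVec, hyU, mulVec_zero, sub_mulVec, smul_mulVec, one_mulVec]
    abel
  have b2 : (G' - (-H - (σ : ℂ) • 1)) *ᵥ y = H *ᵥ y + (σ : ℂ) • y := by
    rw [sub_mulVec, ← h2', ← mulVec_mulVec, hyV, mulVec_zero, sub_mulVec, smul_mulVec, one_mulVec,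
      neg_mulVec]
    abel
  have p1 := hG.dotProduct_mulVec_nonneg x
  have p2 := hG'.dotProduct_mulVec_nonneg x
  have q1 := hN.dotProduct_mulVec_nonneg y
  have q2 := hN'.dotProduct_mulVec_nonneg y
  have hx0 : 0 < star x ⬝ᵥ x := dotProduct_star_self_pos_iff.mpr hx
  have hy0 : 0 < star y ⬝ᵥ y := dotProduct_star_self_pos_iff.mpr hy
  have hs : star x ⬝ᵥ G *ᵥ x + star x ⬝ᵥ G' *ᵥ x = -((τ + σ : ℝ) : ℂ) * (star x ⬝ᵥ x) := by
    rw [a1, a2]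
    simp only [dotProduct_sub, dotProduct_neg, dotProduct_smul, smul_eq_mul]
    push_cast
    ring
  have ht : star y ⬝ᵥ (G - (H - (τ : ℂ) • 1)) *ᵥ y + star y ⬝ᵥ (G' - (-H - (σ : ℂ) • 1)) *ᵥ y =
      ((τ + σ : ℝ) : ℂ) * (star y ⬝ᵥ y) := by
    rw [b1, b2]
    simp only [dotProduct_add, dotProduct_neg, dotProduct_smul, smul_eq_mul]
    push_cast
    ring
  have hτσ : ((τ + σ : ℝ) : ℂ) = 0 := by
    have d1 : 0 ≤ -(τ + σ) := nonneg_of_ofReal_mul_nonneg hx0 (by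
      rw [Complex.ofReal_neg, ← hs]
      exact add_nonneg p1 p2)
    have d2 : 0 ≤ τ + σ := nonneg_of_ofReal_mul_nonneg hy0 (ht ▸ add_nonneg q1 q2)
    exact_mod_cast (le_antisymm (by linarith) d2 : τ + σ = 0)
  rw [hτσ, neg_zero, zero_mul] at hs
  rw [hτσ, zero_mul] at ht
  have hs1 := ((add_eq_zero_iff_of_nonneg p1 p2).mp hs).1
  have ht1 := ((add_eq_zero_iff_of_nonneg q1 q2).mp ht).1
  rw [hG.dotProduct_mulVec_zero_iff, a1, sub_eq_zero] at hs1
  rw [hN.dotProduct_mulVec_zero_iff, b1, neg_add_eq_zero] at ht1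
  exact ⟨hs1, ht1⟩

end Top

section Dimension

open scoped ComplexOrder

variable {n : ℕ}

lemma rank_proj {k : ℕ} (hkn : k ≤ n) {U : Matrix (Fin n) (Fin n) ℂ}
    (hU : U ∈ unitaryGroup (Fin n) ℂ) : (proj k U).rank = k := by
  have h1 : IsUnit U := IsUnit.of_mul_eq_one _ (mul_star_self_of_mem hU)
  have h2 : IsUnit (star U) := IsUnit.of_mul_eq_one _ (star_mul_self_of_mem hU)
  rw [isUnit_iff_isUnit_det] at h1 h2
  rw [proj, dconj, rank_mul_eq_left_of_isUnit_det _ _ h2, rank_mul_eq_right_of_isUnit_det _ _ h1,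
    cdiag, rank_diagonal, Fintype.card_subtype]
  simp only [ind, ne_eq, Complex.ofReal_eq_zero, ite_eq_right_iff, one_ne_zero, imp_false, not_not]
  rw [Fin.card_filter_val_lt, min_eq_right hkn]

lemma mulVec_eq_self_of_mem_range {P : Matrix (Fin n) (Fin n) ℂ} (hPP : P * P = P)
    {x : Fin n → ℂ} (hx : x ∈ LinearMap.range P.mulVecLin) : P *ᵥ x = x := by
  obtain ⟨y, rfl⟩ := hx
  simp [mulVec_mulVec, hPP]

lemma exists_common_of_rank_lt {P Q R : Matrix (Fin n) (Fin n) ℂ} (hP : P * P = P)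
    (hQ : Q * Q = Q) (hRP : R * P = P) (hRQ : R * Q = Q) (h : R.rank < P.rank + Q.rank) :
    ∃ x : Fin n → ℂ, x ≠ 0 ∧ P *ᵥ x = x ∧ Q *ᵥ x = x := by
  by_contra! hcon
  have hinf : LinearMap.range P.mulVecLin ⊓ LinearMap.range Q.mulVecLin = ⊥ := by
    rw [Submodule.eq_bot_iff]
    rintro x ⟨hx1, hx2⟩
    by_contra hx0
    exact hcon x hx0 (mulVec_eq_self_of_mem_range hP hx1) (mulVec_eq_self_of_mem_range hQ hx2)
  have hsup : LinearMap.range P.mulVecLin ⊔ LinearMap.range Q.mulVecLin ≤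
      LinearMap.range R.mulVecLin := by
    refine sup_le ?_ ?_
    · rintro _ ⟨y, rfl⟩
      exact ⟨P *ᵥ y, by simp [mulVec_mulVec, hRP]⟩
    · rintro _ ⟨y, rfl⟩
      exact ⟨Q *ᵥ y, by simp [mulVec_mulVec, hRQ]⟩
  have h1 := Submodule.finrank_sup_add_finrank_inf_eq (LinearMap.range P.mulVecLin)
    (LinearMap.range Q.mulVecLin)
  have h2 := Submodule.finrank_mono hsup
  rw [hinf, finrank_bot, add_zero] at h1
  simp only [rank] at h
  omega

lemma eq_zero_of_disjoint_kernels {P Q : Matrix (Fin n) (Fin n) ℂ} (hP : P.IsHermitian)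
    (hQ : Q.IsHermitian) (h : P.rank + Q.rank ≤ n)
    (hker : ∀ y : Fin n → ℂ, P *ᵥ y = 0 → Q *ᵥ y = 0 → y = 0) {x : Fin n → ℂ}
    (hPx : P *ᵥ x = x) (hQx : Q *ᵥ x = x) : x = 0 := by
  have hinf : LinearMap.ker P.mulVecLin ⊓ LinearMap.ker Q.mulVecLin = ⊥ := by
    rw [Submodule.eq_bot_iff]
    rintro y ⟨hy1, hy2⟩
    exact hker y hy1 hy2
  have h1 := Submodule.finrank_sup_add_finrank_inf_eq (LinearMap.ker P.mulVecLin)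
    (LinearMap.ker Q.mulVecLin)
  have h2 := LinearMap.finrank_range_add_finrank_ker P.mulVecLin
  have h3 := LinearMap.finrank_range_add_finrank_ker Q.mulVecLin
  have h4 := Submodule.finrank_le (LinearMap.ker P.mulVecLin ⊔ LinearMap.ker Q.mulVecLin)
  rw [hinf, finrank_bot, add_zero] at h1
  simp only [Module.finrank_fin_fun] at h2 h3 h4
  simp only [rank] at h
  have htop : LinearMap.ker P.mulVecLin ⊔ LinearMap.ker Q.mulVecLin = ⊤ := by
    apply Submodule.eq_top_of_finrank_eq
    rw [Module.finrank_fin_fun]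
    omega
  have hperp : ∀ (B : Matrix (Fin n) (Fin n) ℂ), B.IsHermitian → B *ᵥ x = x → ∀ z : Fin n → ℂ,
      B *ᵥ z = 0 → star x ⬝ᵥ z = 0 := by
    intro B hB hBx z hz
    rw [← hBx, star_mulVec, ← dotProduct_mulVec, hB.eq, hz, dotProduct_zero]
  obtain ⟨a, ha, b, hb, hab⟩ := Submodule.mem_sup.mp (htop ▸ Submodule.mem_top : x ∈ _)
  have h5 : star x ⬝ᵥ (a + b) = 0 := by
    rw [dotProduct_add, hperp P hP hPx a ha, hperp Q hQ hQx b hb, add_zero]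
  exact dotProduct_star_self_eq_zero.mp (hab ▸ h5)

end Dimension

section Commutator

open scoped ComplexOrder

variable {n m k : ℕ} {ι : Type*} {A : Fin m → Matrix (Fin n) (Fin n) ℂ}
  {U : ι → Matrix (Fin n) (Fin n) ℂ}

lemma isClosed_isMaximizer (c : Fin n → ℝ) (A : Fin m → Matrix (Fin n) (Fin n) ℂ)
    (V : Matrix (Fin n) (Fin n) ℂ) : IsClosed {u : Fin m → ℝ | IsMaximizer c (comb A u) V} := by
  simp only [IsMaximizer, cval_comb, Set.ofPred_and, Set.ofPred_forall]
  refine isClosed_const.inter (isClosed_iInter fun W => isClosed_iInter fun _ => ?_)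
  exact isClosed_le (by fun_prop) (by fun_prop)

lemma commute_comb_proj (hA : ∀ j, (A j).IsHermitian) (hk1 : 1 ≤ k) (hkn : k ≤ n)
    (hexp : ∀ p, ∃ u₀, ∀ w, ∃ ε : ℝ, ε ≠ 0 ∧
      IsMaximizer (ind n k) (comb A (u₀ + ε • w)) (U p)) (p : ι) (w : Fin m → ℝ) :
    Commute (comb A w) (proj k (U p)) := by
  obtain ⟨u₀, hu⟩ := hexp p
  obtain ⟨ε₀, -, h0⟩ := hu 0
  obtain ⟨ε, hε, h1⟩ := hu w
  have c0 := h0.commute_proj (comb_isHermitian hA _) hk1 hkn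
  have c1 := h1.commute_proj (comb_isHermitian hA _) hk1 hkn
  rw [smul_zero, add_zero] at c0
  rw [comb_add, comb_smul] at c1
  have c2 := c1.sub_left c0
  rw [add_sub_cancel_left] at c2
  have c3 := c2.smul_left ((ε : ℂ)⁻¹)
  rwa [smul_smul, inv_mul_cancel₀ (by exact_mod_cast hε), one_smul] at c3

lemma commutator_mul_proj_eq {X Y V W : Matrix (Fin n) (Fin n) ℂ} {a b : ℝ}
    (hab : a ^ 2 + b ^ 2 = 1) (hX : X.IsHermitian) (hY : Y.IsHermitian) (hk1 : 1 ≤ k)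
    (hkn : k ≤ n) (hXV : Commute X (proj k V)) (hXW : Commute X (proj k W))
    (hYV : Commute Y (proj k V)) (hYW : Commute Y (proj k W))
    (hV : IsMaximizer (ind n k) ((a : ℂ) • X + (b : ℂ) • Y) V)
    (hW : IsMaximizer (ind n k) ((a : ℂ) • X + (b : ℂ) • Y) W) :
    (X * Y - Y * X) * proj k V = (X * Y - Y * X) * proj k W := by
  have hZ : ((a : ℂ) • X + (b : ℂ) • Y).IsHermitian := by
    simp [Matrix.IsHermitian, hX.eq, hY.eq]
  obtain ⟨τ, hτ⟩ := hV.exists_mul_proj_sub hW hZ hk1 hkn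
  set D := proj k V - proj k W with hD
  set Z := (a : ℂ) • X + (b : ℂ) • Y with hZdef
  have hXD : Commute X D := hXV.sub_right hXW
  have hYD : Commute Y D := hYV.sub_right hYW
  have key : ∀ S : Matrix (Fin n) (Fin n) ℂ, Commute S D → (S * Z - Z * S) * D = 0 := by
    intro S hS
    rw [sub_mul, mul_assoc, mul_assoc, hτ, hS.eq, ← mul_assoc, hτ, mul_smul_comm, smul_mul_assoc,
      hS.eq, sub_self]
  have h1 : (b : ℂ) • ((X * Y - Y * X) * D) = 0 := by
    rw [← key X hXD, ← smul_mul_assoc, hZdef]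
    congr 1
    simp only [mul_add, add_mul, mul_smul_comm, smul_mul_assoc, smul_sub]
    abel
  have h2 : (a : ℂ) • ((X * Y - Y * X) * D) = 0 := by
    rw [← neg_eq_zero, ← key Y hYD, ← smul_mul_assoc, hZdef, ← neg_mul]
    congr 1
    simp only [mul_add, add_mul, mul_smul_comm, smul_mul_assoc, smul_sub]
    abel
  have h3 : (X * Y - Y * X) * D = 0 := by
    calc (X * Y - Y * X) * D = ((a ^ 2 + b ^ 2 : ℝ) : ℂ) • ((X * Y - Y * X) * D) := by simp [hab]
      _ = (a : ℂ) • (a : ℂ) • ((X * Y - Y * X) * D) +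
          (b : ℂ) • (b : ℂ) • ((X * Y - Y * X) * D) := by
        rw [smul_smul, smul_smul, ← add_smul]
        push_cast
        ring_nf
      _ = 0 := by rw [h1, h2, smul_zero, smul_zero, add_zero]
  rwa [hD, mul_sub, sub_eq_zero] at h3

lemma exists_antipodal [Finite ι] (hA : ∀ j, (A j).IsHermitian) (hk1 : 1 ≤ k) (hkn : k ≤ n)
    (hcov : ∀ u, ∃ p, IsMaximizer (ind n k) (comb A u) (U p))
    (hcomm : ∀ p w, Commute (comb A w) (proj k (U p))) {p : ι} {u : Fin m → ℝ}
    (hp : IsMaximizer (ind n k) (comb A u) (U p)) (w : Fin m → ℝ) :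
    ∃ q, IsMaximizer (ind n k) (-comb A u) (U q) ∧
      (comb A u * comb A w - comb A w * comb A u) * proj k (U q) =
        (comb A u * comb A w - comb A w * comb A u) * proj k (U p) := by
  set T := comb A u * comb A w - comb A w * comb A u with hT
  let F : ι → Set ℝ := fun q =>
    {θ | IsMaximizer (ind n k) (comb A (Real.cos θ • u + Real.sin θ • w)) (U q)}
  have hF : ∀ q, IsClosed (F q) := fun q =>
    (isClosed_isMaximizer (ind n k) A (U q)).preimage (by fun_prop)
  let S : Set ℝ := ⋃ q ∈ {q | T * proj k (U q) = T * proj k (U p)}, F q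
  let S' : Set ℝ := ⋃ q ∈ {q | T * proj k (U q) ≠ T * proj k (U p)}, F q
  have hS : IsClosed S := (Set.toFinite _).isClosed_biUnion fun q _ => hF q
  have hS' : IsClosed S' := (Set.toFinite _).isClosed_biUnion fun q _ => hF q
  have hcompl : Sᶜ = S' := by
    ext θ
    simp only [S, S', Set.mem_compl_iff, Set.mem_iUnion, Set.mem_ofPred_eq, exists_prop, not_exists,
      not_and]
    constructor
    · intro h
      obtain ⟨q, hq⟩ := hcov (Real.cos θ • u + Real.sin θ • w)
      exact ⟨q, fun h1 => h q h1 hq, hq⟩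
    · rintro ⟨q, hq1, hq2⟩ r hr1 hr2
      apply hq1
      rw [← hr1]
      simp only [F, Set.mem_ofPred_eq, comb_add, comb_smul] at hq2 hr2
      exact commutator_mul_proj_eq (Real.cos_sq_add_sin_sq θ) (comb_isHermitian hA u)
        (comb_isHermitian hA w) hk1 hkn (hcomm q u) (hcomm r u) (hcomm q w) (hcomm r w) hq2 hr2
  have huniv : S = Set.univ :=
    IsClopen.eq_univ ⟨hS, isClosed_compl_iff.mp (hcompl ▸ hS')⟩
      ⟨0, Set.mem_biUnion (x := p) rfl (by simpa [F] using hp)⟩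
  have hπ : Real.pi ∈ S := huniv ▸ Set.mem_univ _
  simp only [S, Set.mem_iUnion, Set.mem_ofPred_eq, exists_prop] at hπ
  obtain ⟨q, hq1, hq2⟩ := hπ
  refine ⟨q, ?_, hq1⟩
  simpa [F, comb_neg] using hq2

lemma commutator_mul_proj_eq_zero [Finite ι] (hA : ∀ j, (A j).IsHermitian) (hk1 : 1 ≤ k)
    (hkn : 2 * k ≤ n) (hcov : ∀ u, ∃ p, IsMaximizer (ind n k) (comb A u) (U p))
    (hcomm : ∀ p w, Commute (comb A w) (proj k (U p))) {p : ι} {u : Fin m → ℝ}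
    (hp : IsMaximizer (ind n k) (comb A u) (U p)) (w : Fin m → ℝ) :
    (comb A u * comb A w - comb A w * comb A u) * proj k (U p) = 0 := by
  obtain ⟨q, hq, hTq⟩ := exists_antipodal hA hk1 (by omega) hcov hcomm hp w
  have hX := comb_isHermitian hA u
  have hY := comb_isHermitian hA w
  have hPX := hcomm p u
  have hPY := hcomm p w
  have hQX := hcomm q u
  have hQY := hcomm q w
  set X := comb A u
  set Y := comb A w
  set P := proj k (U p) with hPdef
  set Q := proj k (U q) with hQdef
  set T := X * Y - Y * X with hT
  have hP : P * P = P := proj_mul_self k hp.1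
  have hQ : Q * Q = Q := proj_mul_self k hq.1
  have hPh : P.IsHermitian := proj_isHermitian k _
  have hQh : Q.IsHermitian := proj_isHermitian k _
  have hTP : Commute T P := (hPX.mul_left hPY).sub_left (hPY.mul_left hPX)
  have hTQ : Commute T Q := (hQX.mul_left hQY).sub_left (hQY.mul_left hQX)
  have hTstar : Tᴴ = -T := by
    simp [hT, hX.eq, hY.eq]
  obtain ⟨τ, hτ⟩ := hp.exists_scalar hq hX hk1 (by omega)
  have claim : ∀ x, P *ᵥ x = x → Q *ᵥ x = x → T *ᵥ x = 0 := by
    intro x hx1 hx2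
    by_cases hy : ∃ y : Fin n → ℂ, y ≠ 0 ∧ P *ᵥ y = 0 ∧ Q *ᵥ y = 0
    · obtain ⟨y, hy0, hy1, hy2⟩ := hy
      have hscal : ∀ z, P *ᵥ z = z → Q *ᵥ z = z → X *ᵥ z = τ • z := by
        intro z hz1 hz2
        by_cases hz : z = 0
        · simp [hz]
        · exact (hτ z y hz hy0 hz1 hz2 hy1 hy2).1
      have h1 := hscal x hx1 hx2
      have h2 := hscal (Y *ᵥ x) (by rw [mulVec_mulVec, ← hPY.eq, ← mulVec_mulVec, hx1])
        (by rw [mulVec_mulVec, ← hQY.eq, ← mulVec_mulVec, hx2])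
      rw [hT, sub_mulVec, ← mulVec_mulVec, ← mulVec_mulVec, h1, h2, mulVec_smul, sub_self]
    · push Not at hy
      have hx0 : x = 0 := by
        refine eq_zero_of_disjoint_kernels hPh hQh ?_ (fun y h1 h2 => ?_) hx1 hx2
        · rw [hPdef, hQdef, rank_proj (by omega) hp.1, rank_proj (by omega) hq.1]
          omega
        · by_contra hy0
          exact hy y hy0 h1 h2
      rw [hx0, mulVec_zero]
  have hTTP : T * (T * P) = 0 := by
    apply Matrix.ext_of_mulVec_single
    intro i
    rw [zero_mulVec, ← mulVec_mulVec]
    apply claim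
    · rw [mulVec_mulVec, hTP.eq, ← mul_assoc, hP]
    · rw [mulVec_mulVec, ← hTq, hTQ.eq, ← mul_assoc, hQ]
  rw [← conjTranspose_mul_self_eq_zero, conjTranspose_mul, hPh.eq, hTstar, mul_assoc, neg_mul,
    hTTP, neg_zero, mul_zero]

lemma mul_sub_mul_proj_eq_zero [Finite ι] (hA : ∀ j, (A j).IsHermitian) (hk1 : 1 ≤ k)
    (hkn : 2 * k ≤ n) (hcov : ∀ u, ∃ p, IsMaximizer (ind n k) (comb A u) (U p))
    (hexp : ∀ p, ∃ u₀, ∀ w, ∃ ε : ℝ, ε ≠ 0 ∧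
      IsMaximizer (ind n k) (comb A (u₀ + ε • w)) (U p)) (p : ι) (i j : Fin m) :
    (A i * A j - A j * A i) * proj k (U p) = 0 := by
  have hcomm := commute_comb_proj hA hk1 (by omega) hexp
  obtain ⟨u₀, hu⟩ := hexp p
  obtain ⟨ε₀, -, h0⟩ := hu 0
  obtain ⟨ε, hε, h1⟩ := hu (Pi.single i 1)
  have e0 := commutator_mul_proj_eq_zero hA hk1 hkn hcov hcomm h0 (Pi.single j 1)
  have e1 := commutator_mul_proj_eq_zero hA hk1 hkn hcov hcomm h1 (Pi.single j 1)
  rw [smul_zero, add_zero] at e0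
  rw [comb_add, comb_smul, comb_single] at e1
  rw [comb_single] at e0 e1
  have e2 : (ε : ℂ) • ((A i * A j - A j * A i) * proj k (U p)) = 0 := by
    rw [← sub_eq_zero.mpr (e1.trans e0.symm), ← smul_mul_assoc, smul_sub]
    simp only [add_mul, mul_add, sub_mul, smul_mul_assoc, mul_smul_comm]
    abel
  exact (smul_eq_zero.mp e2).resolve_left (by exact_mod_cast hε)

end Commutator

section Support

open scoped ComplexOrder

variable {n m k : ℕ} {ι : Type*} {A : Fin m → Matrix (Fin n) (Fin n) ℂ}
  {U : ι → Matrix (Fin n) (Fin n) ℂ}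

lemma commute_dconj_of_commute {W B : Matrix (Fin n) (Fin n) ℂ} {a b : Fin n → ℝ}
    (hW : W ∈ unitaryGroup (Fin n) ℂ) (hab : ∀ i j, a i = a j → b i = b j)
    (h : Commute B (dconj W a)) : Commute B (dconj W b) := by
  have hWW := star_mul_self_of_mem hW
  have hWW' := mul_star_self_of_mem hW
  have key : ∀ d : Fin n → ℝ, Commute B (dconj W d) ↔ Commute (star W * B * W) (cdiag d) := by
    intro d
    constructor
    · intro hd
      calc star W * B * W * cdiag d = star W * (B * (W * cdiag d * star W)) * W := by
            simp only [mul_assoc, hWW, mul_one]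
        _ = star W * ((W * cdiag d * star W) * B) * W := by rw [show B * (W * cdiag d * star W) = _ from hd]; rfl
        _ = cdiag d * (star W * B * W) := by
            simp only [← mul_assoc, hWW, one_mul]
    · intro hd
      calc B * (W * cdiag d * star W) = W * ((star W * B * W) * cdiag d) * star W := by
            simp only [← mul_assoc, hWW', one_mul]
        _ = W * (cdiag d * (star W * B * W)) * star W := by rw [hd.eq]
        _ = (W * cdiag d * star W) * B := by
            simp only [mul_assoc, hWW', mul_one]
  rw [key] at h ⊢
  ext i j
  have h1 := congrFun (congrFun h.eq i) j
  simp only [cdiag, mul_diagonal, diagonal_mul] at h1 ⊢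
  by_cases hij : a i = a j
  · rw [hab i j hij, mul_comm]
  · have h2 : (star W * B * W) i j * ((a j : ℂ) - a i) = 0 := by
      rw [mul_sub, h1]
      ring
    have h3 : (star W * B * W) i j = 0 := by
      refine (mul_eq_zero.mp h2).resolve_right fun h4 => hij ?_
      exact_mod_cast (sub_eq_zero.mp h4).symm
    rw [h3, zero_mul, mul_zero]

/-- The projector onto the span of the ranges of finitely many projectors. -/
lemma exists_support_projector [Finite ι] (P : ι → Matrix (Fin n) (Fin n) ℂ)
    (hP : ∀ p, (P p).IsHermitian) (hPP : ∀ p, P p * P p = P p) :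
    ∃ R : Matrix (Fin n) (Fin n) ℂ, R.IsHermitian ∧ R * R = R ∧ (∀ p, R * P p = P p) ∧
      (∀ B, (∀ p, Commute B (P p)) → Commute B R) ∧ ∀ B, (∀ p, B * P p = 0) → B * R = 0 := by
  cases nonempty_fintype ι
  have hPpos : ∀ p, (P p).PosSemidef := fun p => by
    have := posSemidef_conjTranspose_mul_self (P p)
    rwa [(hP p).eq, hPP p] at this
  have hS : (∑ p, P p).PosSemidef := posSemidef_sum _ fun p _ => hPpos p
  obtain ⟨W, hW, hSW⟩ := exists_unitary_eigDesc hS.1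
  set s := eigDesc (∑ p, P p)
  replace hSW : ∑ p, P p = dconj W s := hSW
  have hmul : dconj W s * dconj W s⁻¹ = dconj W (s * s⁻¹) := dconj_mul hW _ _
  have hRR : dconj W (s * s⁻¹) * dconj W (s * s⁻¹) = dconj W (s * s⁻¹) := by
    rw [dconj_mul hW]
    congr 1
    ext i
    by_cases h : s i = 0 <;> simp [h]
  have hRS : dconj W (s * s⁻¹) * dconj W s = dconj W s := by
    rw [dconj_mul hW]
    congr 1
    ext i
    by_cases h : s i = 0 <;> simp [h]
  refine ⟨dconj W (s * s⁻¹), dconj_isHermitian _ _, hRR, fun p => ?_, fun B hB => ?_,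
    fun B hB => ?_⟩
  · set R := dconj W (s * s⁻¹)
    have hRh : R.IsHermitian := dconj_isHermitian _ _
    have hQh : (1 - R).IsHermitian := isHermitian_one.sub hRh
    have h0 : (1 - R) * (∑ p, P p) * (1 - R) = 0 := by
      rw [hSW, sub_mul, hRS]
      simp
    have h1 : ∑ p, (1 - R) * P p * (1 - R) = 0 := by
      rw [← h0, Finset.mul_sum, Finset.sum_mul]
    have h2 : ∑ p, ((1 - R) * P p * (1 - R)).trace = 0 := by
      rw [← trace_sum, h1, trace_zero]
    have hpos : ∀ p, ((1 - R) * P p * (1 - R)).PosSemidef := fun p => by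
      have := (hPpos p).conjTranspose_mul_mul_same (1 - R)
      rwa [hQh.eq] at this
    rw [Finset.sum_eq_zero_iff_of_nonneg fun p _ => (hpos p).trace_nonneg] at h2
    have h3 := (hpos p).trace_eq_zero_iff.mp (h2 p (Finset.mem_univ p))
    have h4 : P p * (1 - R) = 0 := mul_eq_zero_of_conj_eq_zero (hPpos p) (by rw [hQh.eq, h3])
    have h5 := congrArg conjTranspose h4
    rw [conjTranspose_mul, hQh.eq, (hP p).eq, conjTranspose_zero, sub_mul, one_mul,
      sub_eq_zero] at h5
    exact h5.symm
  · apply commute_dconj_of_commute (a := s) hW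
    · intro i j hij
      simp [hij]
    · rw [← hSW]
      exact Commute.sum_right _ _ _ fun p _ => hB p
  · rw [← hmul, ← mul_assoc, ← hSW, Finset.mul_sum, Finset.sum_eq_zero fun p _ => hB p, zero_mul]

lemma exists_commuting_projector [Finite ι] (hA : ∀ j, (A j).IsHermitian) (hk1 : 1 ≤ k)
    (hkn : 2 * k ≤ n) (hcov : ∀ u, ∃ p, IsMaximizer (ind n k) (comb A u) (U p))
    (hexp : ∀ p, ∃ u₀, ∀ w, ∃ ε : ℝ, ε ≠ 0 ∧
      IsMaximizer (ind n k) (comb A (u₀ + ε • w)) (U p)) :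
    ∃ R : Matrix (Fin n) (Fin n) ℂ, R.IsHermitian ∧ R * R = R ∧ 2 * k ≤ R.rank ∧
      (∀ p, R * proj k (U p) = proj k (U p)) ∧ (∀ j, Commute (A j) R) ∧
      ∀ i j, (A i * A j - A j * A i) * R = 0 := by
  have hU : ∀ p, U p ∈ unitaryGroup (Fin n) ℂ := fun p => by
    obtain ⟨u₀, hu⟩ := hexp p
    obtain ⟨ε, -, h⟩ := hu 0
    exact h.1
  have hcomm : ∀ p j, Commute (A j) (proj k (U p)) := fun p j => by
    have := commute_comb_proj hA hk1 (by omega) hexp p (Pi.single j 1)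
    rwa [comb_single] at this
  have hzero := mul_sub_mul_proj_eq_zero hA hk1 hkn hcov hexp
  obtain ⟨R, hR, hRR, hRP, hBR, hBR0⟩ := exists_support_projector (fun p => proj k (U p))
    (fun p => proj_isHermitian k _) (fun p => proj_mul_self k (hU p))
  have hAR : ∀ j, Commute (A j) R := fun j => hBR _ fun p => hcomm p j
  have hAAR : ∀ i j, (A i * A j - A j * A i) * R = 0 := fun i j => hBR0 _ fun p => hzero p i j
  by_cases hrank : 2 * k ≤ R.rank
  · exact ⟨R, hR, hRR, hrank, hRP, hAR, hAAR⟩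
  have hscal : ∀ j, ∃ τ : ℂ, ∀ y, R *ᵥ y = 0 → A j *ᵥ y = τ • y := by
    intro j
    obtain ⟨p, hp⟩ := hcov (Pi.single j 1)
    obtain ⟨q, hq⟩ := hcov (-Pi.single j 1)
    rw [comb_neg] at hq
    rw [comb_single] at hp hq
    obtain ⟨τ, hτ⟩ := hp.exists_scalar hq (hA j) hk1 (by omega)
    obtain ⟨x, hx0, hxp, hxq⟩ := exists_common_of_rank_lt (proj_mul_self k hp.1)
      (proj_mul_self k hq.1) (hRP p) (hRP q) (by
        rw [rank_proj (by omega) hp.1, rank_proj (by omega) hq.1]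
        omega)
    have hker : ∀ p y, R *ᵥ y = 0 → proj k (U p) *ᵥ y = 0 := by
      intro p y hy
      have h1 := congrArg conjTranspose (hRP p)
      rw [conjTranspose_mul, (proj_isHermitian k _).eq, hR.eq] at h1
      rw [← h1, ← mulVec_mulVec, hy, mulVec_zero]
    refine ⟨τ, fun y hy => ?_⟩
    by_cases hy0 : y = 0
    · simp [hy0]
    · exact (hτ x y hx0 hy0 hxp hxq (hker p y hy) (hker q y hy)).2
  have hcommA : ∀ i j, A i * A j - A j * A i = 0 := by
    intro i j
    obtain ⟨τ, hτ⟩ := hscal i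
    obtain ⟨σ, hσ⟩ := hscal j
    have h1 : (A i * A j - A j * A i) * (1 - R) = 0 := by
      apply Matrix.ext_of_mulVec_single
      intro a
      have h2 : R *ᵥ ((1 - R) *ᵥ Pi.single a 1) = 0 := by
        rw [mulVec_mulVec, mul_sub, hRR, mul_one, sub_self, zero_mulVec]
      rw [← mulVec_mulVec, sub_mulVec, ← mulVec_mulVec, ← mulVec_mulVec, hτ _ h2, hσ _ h2,
        mulVec_smul, mulVec_smul, hτ _ h2, hσ _ h2, smul_comm, sub_self, zero_mulVec]
    rw [mul_sub, hAAR, sub_zero, mul_one] at h1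
    exact h1
  refine ⟨1, isHermitian_one, one_mul 1, ?_, fun p => one_mul _, fun j => Commute.one_right _,
    fun i j => by rw [mul_one, hcommA]⟩
  rw [rank_one, Fintype.card_fin]
  exact hkn

end Support

section JointDiagonalization

open scoped ComplexOrder

variable {n m k : ℕ}

lemma exists_unitary_joint_diag {ι : Type*} (T : ι → Matrix (Fin n) (Fin n) ℂ)
    (hT : ∀ j, (T j).IsHermitian) (hC : ∀ i j, Commute (T i) (T j)) :
    ∃ U ∈ unitaryGroup (Fin n) ℂ, ∀ j, ∃ d : Fin n → ℝ, T j = dconj U d := by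
  classical
  have hS : ∀ j, (toEuclideanLin (T j)).IsSymmetric := fun j =>
    isSymmetric_toEuclideanLin_iff.mpr (hT j)
  have hcomm : Pairwise (Function.onFun Commute fun j => toEuclideanLin (T j)) := by
    intro i j _
    have h := (hC i j).eq
    ext x : 1
    simp [toLpLin_apply, mulVec_mulVec, h]
  have hint := LinearMap.IsSymmetric.directSum_isInternal_of_pairwise_commute hS hcomm
  have horth := LinearMap.IsSymmetric.orthogonalFamily_iInf_eigenspaces hS
  set V : (ι → ℂ) → Submodule ℂ (EuclideanSpace ℂ (Fin n)) :=
    fun α => ⨅ j, Module.End.eigenspace (toEuclideanLin (T j)) (α j)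
  have hfin : Finite {α // V α ≠ ⊥} :=
    WellFoundedGT.finite_ne_bot_of_iSupIndep hint.submodule_iSupIndep
  cases nonempty_fintype {α // V α ≠ ⊥}
  have hint' := (DirectSum.isInternal_ne_bot_iff (A := V)).mpr hint
  have hn : Module.finrank ℂ (EuclideanSpace ℂ (Fin n)) = n := by simp
  have horth' : OrthogonalFamily ℂ (fun α : {α // V α ≠ ⊥} => V α) fun α => (V α).subtypeₗᵢ :=
    horth.comp Subtype.val_injective
  let b := hint'.subordinateOrthonormalBasis hn horth'
  have hb : ∀ i, ∃ α : ι → ℂ, ∀ j, toEuclideanLin (T j) (b i) = α j • b i := by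
    intro i
    have h := hint'.subordinateOrthonormalBasis_subordinate hn i horth'
    refine ⟨(hint'.subordinateOrthonormalBasisIndex hn i horth').1, fun j => ?_⟩
    exact Module.End.mem_eigenspace_iff.mp ((Submodule.mem_iInf _).mp h j)
  choose α hα using hb
  let U := (EuclideanSpace.basisFun (Fin n) ℂ).toBasis.toMatrix b
  have hU : U ∈ unitaryGroup (Fin n) ℂ :=
    (EuclideanSpace.basisFun (Fin n) ℂ).toMatrix_orthonormalBasis_mem_unitary b
  refine ⟨U, hU, fun j => ?_⟩
  have hTU : T j * U = U * diagonal fun i => α i j := by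
    ext s t
    have h := congrArg (fun x : EuclideanSpace ℂ (Fin n) => x s) (hα t j)
    simp only [toLpLin_apply, PiLp.smul_apply, smul_eq_mul] at h
    rw [mul_diagonal, mul_comm, mul_apply]
    exact h
  have hdiag : star U * T j * U = diagonal fun i => α i j := by
    rw [mul_assoc, hTU, ← mul_assoc, star_mul_self_of_mem hU, one_mul]
  have hh := star_mul_mul_isHermitian (hT j) U
  rw [hdiag, isHermitian_diagonal_iff] at hh
  refine ⟨fun i => (α i j).re, ?_⟩
  have hcd : cdiag (fun i => (α i j).re) = diagonal fun i => α i j := by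
    rw [cdiag]
    congr 1
    ext i
    exact Complex.conj_eq_iff_re.mp (hh i)
  rw [dconj, hcd, ← hTU, mul_assoc, mul_star_self_of_mem hU, mul_one]

end JointDiagonalization

section Block

open scoped ComplexOrder

variable {n m k : ℕ}

lemma dconj_comp_perm (U : Matrix (Fin n) (Fin n) ℂ) (a : Fin n → ℝ) (σ : Equiv.Perm (Fin n)) :
    dconj (U * star (permU σ)) (a ∘ σ) = dconj U a := by
  have e := star_mul_self_of_mem (permU_mem σ)
  rw [dconj, cdiag_comp_perm]
  have : U * star (permU σ) * (permU σ * cdiag a * star (permU σ)) * star (U * star (permU σ))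
    = U * (star (permU σ) * permU σ) * cdiag a * (star (permU σ) * permU σ) * star U := by
    simp [mul_assoc]
  rw [this, e, mul_one, mul_one, dconj]

lemma star_mul_dconj_mul {U : Matrix (Fin n) (Fin n) ℂ} (hU : U ∈ unitaryGroup (Fin n) ℂ)
    (a : Fin n → ℝ) : star U * dconj U a * U = cdiag a := by
  have e := star_mul_self_of_mem hU
  calc star U * (U * cdiag a * star U) * U = (star U * U) * cdiag a * (star U * U) := by
        simp only [mul_assoc]
    _ = cdiag a := by rw [e, one_mul, mul_one]

lemma cdiag_injective : Function.Injective (cdiag (n := n)) := by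
  intro a b h
  ext i
  have := congrFun (congrFun h i) i
  simpa [cdiag] using this

lemma dconj_injective {U : Matrix (Fin n) (Fin n) ℂ} (hU : U ∈ unitaryGroup (Fin n) ℂ) :
    Function.Injective (dconj U) := by
  intro a b h
  apply cdiag_injective
  rw [← star_mul_dconj_mul hU a, h, star_mul_dconj_mul hU]

lemma exists_eq_ind {a : Fin n → ℝ} (ha : Antitone a) (haa : a * a = a) :
    ∃ l ≤ n, a = ind n l := by
  classical
  have h01 : ∀ i, a i = 0 ∨ a i = 1 := fun i => by
    have h := congrFun haa i
    rw [Pi.mul_apply] at h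
    rcases eq_or_ne (a i) 0 with h0 | h0
    · exact Or.inl h0
    · exact Or.inr (mul_right_cancel₀ h0 (by rw [h, one_mul]))
  have hex : ∃ l : ℕ, ∀ i : Fin n, l ≤ i → a i = 0 := ⟨n, fun i hi => absurd i.2 (by omega)⟩
  refine ⟨Nat.find hex, Nat.find_min' hex fun i hi => absurd i.2 (by omega), ?_⟩
  ext i
  rw [ind]
  split_ifs with h
  · have h1 := Nat.find_min hex h
    push Not at h1
    obtain ⟨j, hij, hj⟩ := h1
    have h2 : a j ≤ a i := ha hij
    rw [(h01 j).resolve_left hj] at h2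
    exact (h01 i).resolve_left fun h3 => by linarith
  · exact Nat.find_spec hex i (not_lt.mp h)

/-- If the commutators of Hermitian matrices vanish on the range of a commuting projector, then
the matrices split off a simultaneously diagonal block of size the rank of the projector. -/
lemma exists_unitary_block {A : Fin m → Matrix (Fin n) (Fin n) ℂ} (hA : ∀ j, (A j).IsHermitian)
    {R : Matrix (Fin n) (Fin n) ℂ} (hR : R.IsHermitian) (hRR : R * R = R)
    (hAR : ∀ j, Commute (A j) R) (hcomm : ∀ i j, (A i * A j - A j * A i) * R = 0) :
    ∃ U ∈ unitaryGroup (Fin n) ℂ, R = proj R.rank U ∧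
      ∀ j, ∀ s t : Fin n, s ≠ t → ((s : ℕ) < R.rank ∨ (t : ℕ) < R.rank) →
        (star U * A j * U) s t = 0 := by
  let T : Option (Fin m) → Matrix (Fin n) (Fin n) ℂ := fun o => o.elim R fun j => A j * R
  have hprod : ∀ i j, A i * R * (A j * R) = A i * A j * R := fun i j => by
    rw [mul_assoc, ← mul_assoc R, ← (hAR j).eq, mul_assoc (A j), hRR, mul_assoc]
  have hT : ∀ o, (T o).IsHermitian := by
    rintro (_ | j)
    · exact hR
    · exact ((hA j).commute_iff hR).mp (hAR j)
  have hRA : ∀ j, R * (A j * R) = A j * R := fun j => by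
    rw [← mul_assoc, ← (hAR j).eq, mul_assoc, hRR]
  have hC : ∀ i j, Commute (T i) (T j) := by
    rintro (_ | i) (_ | j)
    · exact Commute.refl _
    · change R * (A j * R) = A j * R * R
      rw [hRA, mul_assoc, hRR]
    · change A i * R * R = R * (A i * R)
      rw [hRA, mul_assoc, hRR]
    · change A i * R * (A j * R) = A j * R * (A i * R)
      rw [hprod, hprod, ← sub_eq_zero, ← sub_mul, hcomm]
  obtain ⟨U₀, hU₀, hd⟩ := exists_unitary_joint_diag T hT hC
  choose d hd using hd
  obtain ⟨σ, hσ⟩ := exists_perm_antitone (d none)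
  have hU : U₀ * star (permU σ) ∈ unitaryGroup (Fin n) ℂ :=
    mul_mem hU₀ (star_mem_unitaryGroup (permU_mem σ))
  set U := U₀ * star (permU σ)
  have hdU : ∀ o, T o = dconj U (d o ∘ σ) := fun o => by rw [dconj_comp_perm, ← hd]
  have hR0 : R = dconj U (d none ∘ σ) := hdU none
  obtain ⟨l, hl, hdl⟩ := exists_eq_ind hσ <| dconj_injective hU <| by
    rw [← dconj_mul hU, ← hR0, hRR]
  have hRl : R = proj l U := by rw [proj, ← hdl]; exact hR0
  have hrank : R.rank = l := by rw [hRl, rank_proj hl hU]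
  rw [hrank]
  refine ⟨U, hU, hRl, fun j => ?_⟩
  have hB : star U * A j * U * cdiag (ind n l) = cdiag (d (some j) ∘ σ) := by
    rw [← star_mul_dconj_mul hU, ← star_mul_dconj_mul hU, ← hdU (some j), ← proj, ← hRl]
    calc star U * A j * U * (star U * R * U) = star U * A j * (U * star U) * R * U := by
          simp only [mul_assoc]
      _ = star U * (A j * R) * U := by
          rw [mul_star_self_of_mem hU, mul_one, mul_assoc (star U)]
  have hcol : ∀ s t : Fin n, s ≠ t → (t : ℕ) < l → (star U * A j * U) s t = 0 := by
    intro s t hst ht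
    have := congrFun (congrFun hB s) t
    rw [cdiag, mul_diagonal] at this
    simpa [ind, ht, cdiag, hst] using this
  rintro s t hst (h | h)
  · have := (star_mul_mul_isHermitian (hA j) U).apply s t
    rw [← this, hcol t s hst.symm h, star_zero]
  · exact hcol s t hst h

end Block

section Reduction

open scoped ComplexOrder

variable {n m k : ℕ}

lemma jointCNumRangeR_neg (C : Matrix (Fin n) (Fin n) ℂ) (A : Fin m → Matrix (Fin n) (Fin n) ℂ) :
    jointCNumRangeR (-C) A = -jointCNumRangeR C A := by
  ext p
  simp only [jointCNumRangeR, Set.mem_neg, Set.mem_ofPred_eq, Pi.neg_apply, Complex.ofReal_neg,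
    neg_mul, trace_neg, neg_eq_iff_eq_neg]

lemma gammaC_bddAbove (C : Matrix (Fin n) (Fin n) ℂ) :
    BddAbove { t : ℕ | ∃ (j : ℕ) (_ : 1 ≤ j) (h2 : j < n),
      eigDesc C ⟨j - 1, by omega⟩ > eigDesc C ⟨j, h2⟩ ∧
      ((t = j ∧ 2 * j ≤ n) ∨ (t = n - j ∧ 2 * (n - j) ≤ n)) } := by
  refine ⟨n, ?_⟩
  rintro t ⟨j, h1, h2, -, h | h⟩ <;> omega

lemma exists_gap_of_gammaC {C : Matrix (Fin n) (Fin n) ℂ} (hk1 : 1 ≤ k) (hC : gammaC C = k) :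
    ∃ (j : ℕ) (_ : 1 ≤ j) (h2 : j < n), eigDesc C ⟨j, h2⟩ < eigDesc C ⟨j - 1, by omega⟩ ∧
      ((k = j ∧ 2 * j ≤ n) ∨ (k = n - j ∧ 2 * (n - j) ≤ n)) := by
  rw [gammaC] at hC
  rw [← hC]
  refine Nat.sSup_mem ?_ (gammaC_bddAbove C)
  by_contra hne
  rw [Set.not_nonempty_iff_eq_empty] at hne
  rw [hne] at hC
  simp at hC
  omega

/-- Up to a unitary similarity and a sign, the weights drop right after the `γ(C)`-th one. -/
lemma exists_antitone_gap {C : Matrix (Fin n) (Fin n) ℂ} (hC : C.IsHermitian) (hk1 : 1 ≤ k)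
    (hkn : k < n) (hCk : gammaC C = k) {A : Fin m → Matrix (Fin n) (Fin n) ℂ}
    (hpoly : IsPolyhedral (convexHull ℝ (jointCNumRangeR C A))) :
    ∃ c : Fin n → ℝ, Antitone c ∧ c ⟨k, hkn⟩ < c ⟨k - 1, by omega⟩ ∧
      IsPolyhedral (convexHull ℝ (jointCNumRangeR (cdiag c) A)) := by
  obtain ⟨U, hU, h⟩ := exists_unitary_eigDesc hC
  rw [h, jointCNumRangeR_conj _ _ hU] at hpoly
  have hanti := eigDesc_antitone C
  obtain ⟨j, hj1, hjn, hgap, ⟨rfl, _⟩ | ⟨rfl, _⟩⟩ := exists_gap_of_gammaC hk1 hCk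
  · exact ⟨eigDesc C, hanti, hgap, hpoly⟩
  · refine ⟨(-eigDesc C) ∘ Fin.revPerm, fun s t hst => ?_, ?_, ?_⟩
    · exact neg_le_neg (hanti (Fin.rev_le_rev.mpr hst))
    · have e1 : Fin.rev ⟨n - j, hkn⟩ = (⟨j - 1, by omega⟩ : Fin n) := by
        ext; simp only [Fin.val_rev]; omega
      have e2 : Fin.rev ⟨n - j - 1, by omega⟩ = (⟨j, hjn⟩ : Fin n) := by
        ext; simp only [Fin.val_rev]; omega
      simp only [Function.comp, Fin.revPerm_apply, Pi.neg_apply, e1, e2]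
      exact neg_lt_neg hgap
    · have hn : cdiag (-eigDesc C) = -cdiag (eigDesc C) := by
        simp [cdiag]
      rw [jointCNumRangeR_comp_perm, hn, jointCNumRangeR_neg, convexHull_neg]
      exact hpoly.image_neg

/-- A polyhedral convex hull is the convex hull of finitely many points, each of which is the
unique maximizer of some linear functional, even after a small perturbation. -/
lemma exists_maximizer_family {A : Fin m → Matrix (Fin n) (Fin n) ℂ}
    (hA : ∀ j, (A j).IsHermitian) (c : Fin n → ℝ)
    (hpoly : IsPolyhedral (convexHull ℝ (jointCNumRangeR (cdiag c) A))) :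
    ∃ (E : Set (Fin m → ℝ)) (U : E → Matrix (Fin n) (Fin n) ℂ), E.Finite ∧
      (∀ u, ∃ p, IsMaximizer c (comb A u) (U p)) ∧
      ∀ p, ∃ u₀, ∀ w, ∃ ε : ℝ, ε ≠ 0 ∧ IsMaximizer c (comb A (u₀ + ε • w)) (U p) := by
  set S := jointCNumRangeR (cdiag c) A with hSdef
  obtain ⟨F, hF, hSF⟩ := hpoly
  set E := (convexHull ℝ S).extremePoints ℝ with hE
  have hES : E ⊆ S := extremePoints_convexHull_subset
  have hEF : E ⊆ F := by
    rw [hE, hSF]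
    exact extremePoints_convexHull_subset
  have hEfin : E.Finite := hF.subset hEF
  have hcomp : IsCompact (convexHull ℝ S) := by
    rw [hSF]
    exact hF.isCompact_convexHull ℝ
  have hEhull : convexHull ℝ E = convexHull ℝ S := by
    have := closure_convexHull_extremePoints hcomp (convex_convexHull ℝ S)
    rwa [(hEfin.isClosed_convexHull ℝ).closure_eq] at this
  have hmem : ∀ p : E, ∃ U ∈ unitaryGroup (Fin n) ℂ, (p : Fin m → ℝ) = cpoint c A U := fun p =>
    (mem_jointCNumRangeR_cdiag hA c p).mp (hES p.2)
  choose U hU hpU using hmem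
  have hmax : ∀ (p : E) (u : Fin m → ℝ), (∀ q ∈ E, u ⬝ᵥ q ≤ u ⬝ᵥ (p : Fin m → ℝ)) →
      IsMaximizer c (comb A u) (U p) := by
    refine fun p u h => ⟨hU p, fun V hV => ?_⟩
    rw [cval_comb, cval_comb, ← hpU]
    refine dotProduct_le_of_mem_convexHull (S := E) ?_ h
    rw [hEhull]
    exact subset_convexHull ℝ S ((mem_jointCNumRangeR_cdiag hA c _).mpr ⟨V, hV, rfl⟩)
  have hEne : E.Nonempty := by
    rw [← convexHull_nonempty_iff (𝕜 := ℝ), hEhull, convexHull_nonempty_iff]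
    exact ⟨_, (mem_jointCNumRangeR_cdiag hA c _).mpr ⟨1, one_mem _, rfl⟩⟩
  refine ⟨E, U, hEfin, fun u => ?_, fun p => ?_⟩
  · obtain ⟨p, hp, h⟩ := Set.exists_max_image E (fun q => u ⬝ᵥ q) hEfin hEne
    exact ⟨⟨p, hp⟩, hmax _ _ h⟩
  · have hp : (p : Fin m → ℝ) ∉ convexHull ℝ (E \ {(p : Fin m → ℝ)}) := by
      have h := ((convex_convexHull ℝ S).mem_extremePoints_iff_mem_sdiff_convexHull_sdiff.mp p.2).2
      exact fun h' => h (convexHull_mono (Set.sdiff_subset_sdiff_left extremePoints_subset) h')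
    have hcl : IsClosed (convexHull ℝ (E \ {(p : Fin m → ℝ)})) :=
      (hEfin.subset Set.sdiff_subset).isClosed_convexHull ℝ
    obtain ⟨f, b, hlt, hb⟩ := geometric_hahn_banach_closed_point (convex_convexHull ℝ _) hcl hp
    obtain ⟨u₀, hu₀⟩ := exists_dotProduct_eq f
    refine ⟨u₀, fun w => ?_⟩
    have hev : ∀ᶠ ε : ℝ in nhdsWithin 0 {0}ᶜ, ∀ q ∈ E,
        (u₀ + ε • w) ⬝ᵥ q ≤ (u₀ + ε • w) ⬝ᵥ (p : Fin m → ℝ) := by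
      rw [Filter.eventually_all_finite hEfin]
      intro q hq
      refine Filter.Eventually.filter_mono nhdsWithin_le_nhds ?_
      rcases eq_or_ne q p with rfl | hqp
      · exact Filter.Eventually.of_forall fun _ => le_rfl
      · have hq0 : u₀ ⬝ᵥ q < u₀ ⬝ᵥ (p : Fin m → ℝ) := by
          rw [← hu₀, ← hu₀]
          exact (hlt q (subset_convexHull ℝ _ ⟨hq, hqp⟩)).trans hb
        have hc1 : Continuous fun ε : ℝ => (u₀ + ε • w) ⬝ᵥ q := by fun_prop
        have hc2 : Continuous fun ε : ℝ => (u₀ + ε • w) ⬝ᵥ (p : Fin m → ℝ) := by fun_prop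
        have := (isOpen_lt hc1 hc2).mem_nhds (x := (0 : ℝ)) (by simpa using hq0)
        filter_upwards [this] with ε hε using le_of_lt hε
    obtain ⟨ε, hε, hε0⟩ := (hev.and self_mem_nhdsWithin).exists
    exact ⟨ε, hε0, hmax p _ hε⟩

end Reduction

section Embedding

open scoped ComplexOrder

variable {n m k l : ℕ}

lemma exists_perm_comp_eq {f e : Fin l → Fin n} (hf : Function.Injective f)
    (he : Function.Injective e) : ∃ σ : Equiv.Perm (Fin n), ∀ i, σ (f i) = e i := by
  classical
  refine ⟨((Equiv.ofInjective f hf).symm.trans (Equiv.ofInjective e he)).extendSubtype,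
    fun i => ?_⟩
  rw [Equiv.extendSubtype_apply_of_mem _ _ (Set.mem_range_self i)]
  simp only [Equiv.trans_apply, Equiv.ofInjective_symm_apply, Equiv.ofInjective_apply]

/-- A compression to coordinates has a smaller numerical range, after padding the weights with
zeros. -/
lemma jointCNumRangeR_submatrix_subset {f e : Fin l → Fin n} (hf : Function.Injective f)
    (he : Function.Injective e) {c : Fin n → ℝ} (hc : ∀ i, i ∉ Set.range e → c i = 0)
    (A : Fin m → Matrix (Fin n) (Fin n) ℂ) {U : Matrix (Fin n) (Fin n) ℂ}
    (hU : U ∈ unitaryGroup (Fin n) ℂ) :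
    jointCNumRangeR (cdiag (c ∘ e)) (fun j => (star U * A j * U).submatrix f f) ⊆
      jointCNumRangeR (cdiag c) A := by
  classical
  obtain ⟨σ, hσ⟩ := exists_perm_comp_eq hf he
  rw [← jointCNumRangeR_comp_perm c A σ]
  set x := c ∘ σ with hx
  have hxf : c ∘ e = x ∘ f := by
    ext i
    simp [hx, hσ]
  have hx0 : ∀ i, i ∉ Set.range f → x i = 0 := fun i hi => by
    refine hc _ fun ⟨a, ha⟩ => hi ⟨a, ?_⟩
    exact σ.injective (by rw [hσ, ha])
  let J : Matrix (Fin n) (Fin l) ℂ := (1 : Matrix (Fin n) (Fin n) ℂ).submatrix id f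
  have hJJ : Jᴴ * J = 1 := by
    ext s t
    simp [J, mul_apply, one_apply, hf.eq_iff, eq_comm]
  have hJsub : ∀ B : Matrix (Fin n) (Fin n) ℂ, B.submatrix f f = Jᴴ * B * J := fun B => by
    ext s t
    simp [J, mul_apply, one_apply]
  have hJc : cdiag x = J * cdiag (x ∘ f) * Jᴴ := by
    ext s t
    simp only [J, cdiag, mul_apply, conjTranspose_apply, submatrix_apply, one_apply,
      diagonal_apply, id]
    by_cases hs : s ∈ Set.range f
    · obtain ⟨a, rfl⟩ := hs
      rw [Finset.sum_eq_single a]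
      · by_cases hat : f a = t
        · simp [hat]
        · simp [hat, Ne.symm hat]
      · intro b _ hb
        simp [hf.ne hb.symm]
      · simp
    · rw [hx0 s hs, Finset.sum_eq_zero]
      · simp
      · intro b _
        simp [show s ≠ f b from fun h => hs ⟨b, h.symm⟩]
  rintro p ⟨V, hV, hp⟩
  have hVV := star_mul_self_of_mem hV
  let Y : Matrix (Fin n) (Fin n) ℂ := J * V * Jᴴ + (1 - J * Jᴴ)
  have hYJ : Y * J = J * V := by
    calc Y * J = J * V * (Jᴴ * J) + (J - J * (Jᴴ * J)) := by
          simp only [Y, Matrix.add_mul, Matrix.sub_mul, Matrix.one_mul, Matrix.mul_assoc]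
      _ = J * V := by rw [hJJ, Matrix.mul_one, Matrix.mul_one, sub_self, add_zero]
  have hYs : Yᴴ = J * Vᴴ * Jᴴ + (1 - J * Jᴴ) := by
    simp [Y, conjTranspose_add, conjTranspose_sub, conjTranspose_mul, Matrix.mul_assoc]
  have hYY : Y ∈ unitaryGroup (Fin n) ℂ := by
    rw [mem_unitaryGroup_iff']
    change Yᴴ * Y = 1
    have h1 : Yᴴ * J = J * Vᴴ := by
      rw [hYs]
      calc _ = J * Vᴴ * (Jᴴ * J) + (J - J * (Jᴴ * J)) := by
            simp only [Matrix.add_mul, Matrix.sub_mul, Matrix.one_mul, Matrix.mul_assoc]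
        _ = J * Vᴴ := by rw [hJJ, Matrix.mul_one, Matrix.mul_one, sub_self, add_zero]
    calc Yᴴ * Y = Yᴴ * J * V * Jᴴ + (Yᴴ - Yᴴ * J * Jᴴ) := by
          simp only [Y, mul_add, mul_sub, mul_one, Matrix.mul_assoc]
      _ = J * (Vᴴ * V) * Jᴴ + (1 - J * Jᴴ) := by
          rw [h1, hYs, Matrix.mul_assoc J]
          abel
      _ = 1 := by
          rw [show Vᴴ * V = 1 from hVV, Matrix.mul_one]
          abel
  refine ⟨U * Y, mul_mem hU hYY, fun j => ?_⟩
  rw [hp j, hxf, hJc]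
  simp only [hJsub]
  change (cdiag (x ∘ f) * (Vᴴ * (Jᴴ * (Uᴴ * A j * U) * J) * V)).trace =
    (J * cdiag (x ∘ f) * Jᴴ * ((U * Y)ᴴ * A j * (U * Y))).trace
  rw [Matrix.mul_assoc J, Matrix.mul_assoc J, trace_mul_comm J, conjTranspose_mul]
  have h2 : Jᴴ * Yᴴ = Vᴴ * Jᴴ := by rw [← conjTranspose_mul, hYJ, conjTranspose_mul]
  congr 1
  calc cdiag (x ∘ f) * (Vᴴ * (Jᴴ * (Uᴴ * A j * U) * J) * V)
      = cdiag (x ∘ f) * ((Vᴴ * Jᴴ) * (Uᴴ * A j * U) * (J * V)) := by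
        simp only [Matrix.mul_assoc]
    _ = _ := by
        rw [← h2, ← hYJ]
        simp only [Matrix.mul_assoc]

end Embedding

section Interlacing

open scoped ComplexOrder

variable {n m k l : ℕ}

lemma exists_unitary_diag_of_block {r : ℕ} {B : Matrix (Fin (l + r)) (Fin (l + r)) ℂ}
    (hB : B.IsHermitian)
    (hblk : ∀ s t : Fin (l + r), s ≠ t → ((s : ℕ) < l ∨ (t : ℕ) < l) → B s t = 0) :
    ∃ W ∈ unitaryGroup (Fin (l + r)) ℂ, ∃ b : Fin (l + r) → ℝ, B = W * cdiag b * star W ∧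
      B.submatrix (Fin.castAdd r) (Fin.castAdd r) = cdiag (b ∘ Fin.castAdd r) := by
  have hQ : (B.submatrix (Fin.natAdd l) (Fin.natAdd l)).IsHermitian := hB.submatrix _
  obtain ⟨V, hV, hQV⟩ := exists_unitary_diag hQ
  set a := hQ.eigenvalues
  let d : Fin l → ℝ := fun i => (B (Fin.castAdd r i) (Fin.castAdd r i)).re
  have hd : B.submatrix (Fin.castAdd r) (Fin.castAdd r) = cdiag d := by
    ext s t
    rw [submatrix_apply, cdiag, diagonal_apply]
    split_ifs with hst
    · subst hst
      exact (Complex.conj_eq_iff_re.mp (hB.apply _ _)).symm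
    · exact hblk (Fin.castAdd r s) (Fin.castAdd r t) (by simpa using hst) (Or.inl (by simp))
  let e : Fin l ⊕ Fin r ≃ Fin (l + r) := finSumFinEquiv
  have hBe : B = (fromBlocks (cdiag d) 0 0 (V * cdiag a * star V)).submatrix e.symm e.symm := by
    rw [← submatrix_id_id B, ← Equiv.self_comp_symm e, ← submatrix_submatrix]
    congr 1
    rw [← hd, ← hQV]
    ext (s | s) (t | t)
    · rfl
    · exact hblk (Fin.castAdd r s) (Fin.natAdd l t) (by simp [Fin.ext_iff]; omega) (Or.inl (by simp))
    · exact hblk (Fin.natAdd l s) (Fin.castAdd r t) (by simp [Fin.ext_iff]; omega) (Or.inr (by simp))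
    · rfl
  let b : Fin (l + r) → ℝ := Sum.elim d a ∘ e.symm
  have hb : cdiag b = (fromBlocks (cdiag d) 0 0 (cdiag a)).submatrix e.symm e.symm := by
    rw [cdiag, cdiag, cdiag, fromBlocks_diagonal, submatrix_diagonal_equiv]
    congr 1
    ext i
    simp only [b, Function.comp]
    cases e.symm i <;> rfl
  have hstar : star ((fromBlocks 1 0 0 V).submatrix e.symm e.symm) =
      (fromBlocks 1 0 0 (star V)).submatrix e.symm e.symm := by
    rw [star_eq_conjTranspose, conjTranspose_submatrix, fromBlocks_conjTranspose]
    simp [star_eq_conjTranspose]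
  refine ⟨(fromBlocks 1 0 0 V).submatrix e.symm e.symm, ?_, b, ?_, ?_⟩
  · rw [mem_unitaryGroup_iff, hstar, submatrix_mul_equiv, fromBlocks_multiply]
    simp [mul_star_self_of_mem hV]
  · rw [hstar, hb, submatrix_mul_equiv, submatrix_mul_equiv, fromBlocks_multiply,
      fromBlocks_multiply, hBe]
    simp
  · rw [hd]
    congr 1
    ext i
    simp [b, e]

/-- The eigenvalues of a diagonal block form a subfamily of all eigenvalues. -/
lemma exists_subfamily_eigenvalues (hl : l ≤ n) {H U : Matrix (Fin n) (Fin n) ℂ}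
    (hH : H.IsHermitian) (hU : U ∈ unitaryGroup (Fin n) ℂ)
    (hblk : ∀ s t : Fin n, s ≠ t → ((s : ℕ) < l ∨ (t : ℕ) < l) → (star U * H * U) s t = 0) :
    ∃ (lam : Fin n → ℝ) (mu : Fin l → ℝ), Antitone lam ∧ Antitone mu ∧
      (∃ W ∈ unitaryGroup (Fin n) ℂ, H = W * cdiag lam * star W) ∧
      (∃ V ∈ unitaryGroup (Fin l) ℂ,
        (star U * H * U).submatrix (Fin.castLE hl) (Fin.castLE hl) = V * cdiag mu * star V) ∧
      ∃ e : Fin l → Fin n, Function.Injective e ∧ mu = lam ∘ e := by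
  obtain ⟨r, rfl⟩ := Nat.exists_eq_add_of_le hl
  obtain ⟨W, hW, b, hb, hbl⟩ := exists_unitary_diag_of_block (star_mul_mul_isHermitian hH U) hblk
  obtain ⟨σ, hσ⟩ := exists_perm_antitone b
  obtain ⟨τ, hτ⟩ := exists_perm_antitone (b ∘ Fin.castAdd r)
  have hUW : H = (U * W) * cdiag b * star (U * W) := by
    have h := mul_star_self_of_mem hU
    calc H = (U * star U) * H * (U * star U) := by rw [h, one_mul, mul_one]
      _ = U * (star U * H * U) * star U := by simp only [mul_assoc]
      _ = _ := by rw [hb, star_mul]; simp only [mul_assoc]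
  have hcast : (Fin.castLE hl : Fin l → Fin (l + r)) = Fin.castAdd r := rfl
  rw [hcast]
  refine ⟨b ∘ σ, (b ∘ Fin.castAdd r) ∘ τ, hσ, hτ, unitary_diag_comp (mul_mem hU hW) hUW σ,
    unitary_diag_comp (one_mem _) (by rw [star_one, one_mul, mul_one]; exact hbl) τ,
    σ.symm ∘ Fin.castAdd r ∘ τ, ?_, ?_⟩
  · exact σ.symm.injective.comp ((Fin.castAdd_injective l r).comp τ.injective)
  · ext i
    simp

lemma eq_of_ind_dotProduct_le {f : Fin l → ℝ} {g : Fin n → ℝ} (hf : Antitone f) (hg : Antitone g)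
    {e : Fin l → Fin n} (he : Function.Injective e) (hfg : f = g ∘ e) (hl : l ≤ n) {k : ℕ}
    (hk : k ≤ l) (h : ind n k ⬝ᵥ g ≤ ind l k ⬝ᵥ f) (i : Fin l) (j : Fin n) (hij : (j : ℕ) = i)
    (hik : (i : ℕ) < k) : f i = g j := by
  have hle : ∀ i : Fin l, f i ≤ g (Fin.castLE hl i) := fun i =>
    le_of_comp_injective hf hg he hfg i _ rfl
  have hsum : ind n k ⬝ᵥ g = ∑ i, ind l k i * g (Fin.castLE hl i) := by
    refine (Fintype.sum_of_injective (Fin.castLE hl) (Fin.castLE_injective hl) _ _ ?_ ?_).symm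
    · intro a ha
      have : ¬ (a : ℕ) < k := fun hak => ha ⟨⟨a, by omega⟩, rfl⟩
      simp [ind, this]
    · intro a
      simp [ind]
  have heq : ∑ i, ind l k i * f i = ∑ i, ind l k i * g (Fin.castLE hl i) := by
    refine le_antisymm (Finset.sum_le_sum fun a _ => ?_) (hsum ▸ h)
    refine mul_le_mul_of_nonneg_left (hle a) ?_
    rw [ind]
    split_ifs <;> norm_num
  rw [Finset.sum_eq_sum_iff_of_le] at heq
  · have h1 := heq i (Finset.mem_univ _)
    simp only [ind, hik, if_true, one_mul] at h1
    rw [h1]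
    congr 1
    exact Fin.ext hij.symm
  · intro a _
    refine mul_le_mul_of_nonneg_left (hle a) ?_
    rw [ind]
    split_ifs <;> norm_num

end Interlacing

section OuterIndices

open scoped ComplexOrder

variable {n m k l : ℕ}

/-- The embedding of `Fin l` in `Fin n` hitting the first `k` and the last `l - k` indices. -/
def outerEmb (hl : l ≤ n) (k : ℕ) (i : Fin l) : Fin n :=
  if (i : ℕ) < k then ⟨i, by omega⟩ else ⟨i + n - l, by omega⟩

lemma outerEmb_val (hl : l ≤ n) (k : ℕ) (i : Fin l) :
    (outerEmb hl k i : ℕ) = if (i : ℕ) < k then (i : ℕ) else i + n - l := by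
  rw [outerEmb]
  split_ifs <;> rfl

lemma outerEmb_strictMono (hl : l ≤ n) (k : ℕ) : StrictMono (outerEmb hl k) := by
  intro i j hij
  have : (i : ℕ) < j := hij
  rw [Fin.lt_def, outerEmb_val, outerEmb_val]
  split_ifs <;> omega

lemma exists_outerEmb_eq (hl : l ≤ n) (hkl : k ≤ l) (a : Fin n) (ha : (a : ℕ) < k ∨ k + n ≤ a + l) :
    a ∈ Set.range (outerEmb hl k) := by
  by_cases hak : (a : ℕ) < k
  · refine ⟨⟨a, by omega⟩, Fin.ext ?_⟩
    rw [outerEmb_val]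
    simp [hak]
  · refine ⟨⟨a + l - n, by omega⟩, Fin.ext ?_⟩
    rw [outerEmb_val, if_neg] <;> simp only [] <;> omega

lemma comb_submatrix (A : Fin m → Matrix (Fin n) (Fin n) ℂ) (U : Matrix (Fin n) (Fin n) ℂ)
    (f : Fin l → Fin n) (u : Fin m → ℝ) :
    comb (fun j => (star U * A j * U).submatrix f f) u =
      (star U * comb A u * U).submatrix f f := by
  ext s t
  simp [comb, Finset.mul_sum, Finset.sum_mul, Matrix.sum_apply]

lemma neg_comp_rev_antitone {f : Fin n → ℝ} (hf : Antitone f) : Antitone (-(f ∘ Fin.rev)) :=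
  fun _ _ hst => neg_le_neg (hf (Fin.rev_le_rev.mpr hst))

lemma unitary_diag_neg_rev {H W : Matrix (Fin n) (Fin n) ℂ} {a : Fin n → ℝ}
    (hW : W ∈ unitaryGroup (Fin n) ℂ) (h : H = W * cdiag a * star W) :
    ∃ V ∈ unitaryGroup (Fin n) ℂ, -H = V * cdiag (-(a ∘ Fin.rev)) * star V := by
  have hn : cdiag (-a) = -cdiag a := by simp [cdiag]
  exact unitary_diag_comp (a := -a) hW (by rw [h, hn]; simp) Fin.revPerm

end OuterIndices

section BlockRange

open scoped ComplexOrder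

variable {n m k l : ℕ} {A : Fin m → Matrix (Fin n) (Fin n) ℂ} {U : Matrix (Fin n) (Fin n) ℂ}

lemma ind_dotProduct_le_of_range_subset (hl : l ≤ n) (hA : ∀ j, (A j).IsHermitian)
    (hW : jointCNumRangeR (cdiag (ind n k)) A ⊆ jointCNumRangeR (cdiag (ind l k))
      (fun j => (star U * A j * U).submatrix (Fin.castLE hl) (Fin.castLE hl)))
    {u : Fin m → ℝ} {lam : Fin n → ℝ} {mu : Fin l → ℝ} (hmu : Antitone mu)
    (hlamW : ∃ W ∈ unitaryGroup (Fin n) ℂ, comb A u = W * cdiag lam * star W)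
    (hmuV : ∃ V ∈ unitaryGroup (Fin l) ℂ,
      (star U * comb A u * U).submatrix (Fin.castLE hl) (Fin.castLE hl) = V * cdiag mu * star V) :
    ind n k ⬝ᵥ lam ≤ ind l k ⬝ᵥ mu := by
  obtain ⟨W, hWu, hlam⟩ := hlamW
  obtain ⟨V, hV, hmuV⟩ := hmuV
  have hD : ∀ j, ((star U * A j * U).submatrix (Fin.castLE hl) (Fin.castLE hl)).IsHermitian :=
    fun j => (star_mul_mul_isHermitian (hA j) U).submatrix _
  have h1 := hW ((mem_jointCNumRangeR_cdiag hA _ _).mpr ⟨W, hWu, rfl⟩)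
  obtain ⟨V', hV', h2⟩ := (mem_jointCNumRangeR_cdiag hD _ _).mp h1
  have h3 := congrArg (fun p => u ⬝ᵥ p) h2
  rw [← cval_comb, ← cval_comb, cval_eigen _ hWu hlam, comb_submatrix] at h3
  rw [dotProduct_comm, h3, dotProduct_comm]
  exact cval_le (ind_antitone l k) hmu hV hmuV hV'

/-- If the block attains the full `k`-numerical range, then it attains every numerical range whose
weights vanish between the first `k` and the last `k` indices. -/
lemma jointCNumRangeR_eq_block (hl : l ≤ n) (hkl : 2 * k ≤ l) (hA : ∀ j, (A j).IsHermitian)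
    (hU : U ∈ unitaryGroup (Fin n) ℂ)
    (hblk : ∀ j, ∀ s t : Fin n, s ≠ t → ((s : ℕ) < l ∨ (t : ℕ) < l) → (star U * A j * U) s t = 0)
    (hW : jointCNumRangeR (cdiag (ind n k)) A ⊆ jointCNumRangeR (cdiag (ind l k))
      (fun j => (star U * A j * U).submatrix (Fin.castLE hl) (Fin.castLE hl)))
    {c : Fin n → ℝ} (hc : Antitone c) (hc0 : ∀ i : Fin n, k ≤ i → (i : ℕ) + k < n → c i = 0) :
    jointCNumRangeR (cdiag c) A = jointCNumRangeR (cdiag (c ∘ outerEmb hl k))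
      (fun j => (star U * A j * U).submatrix (Fin.castLE hl) (Fin.castLE hl)) ∧
    IsPolyhedral (jointCNumRangeR (cdiag c) A) := by
  set D : Fin m → Matrix (Fin l) (Fin l) ℂ :=
    fun j => (star U * A j * U).submatrix (Fin.castLE hl) (Fin.castLE hl) with hDdef
  have hD : ∀ j, (D j).IsHermitian :=
    fun j => (star_mul_mul_isHermitian (hA j) U).submatrix _
  have hĉ : Antitone (c ∘ outerEmb hl k) := hc.comp_monotone (outerEmb_strictMono hl k).monotone
  have hcr : ∀ i, i ∉ Set.range (outerEmb hl k) → c i = 0 := by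
    intro i hi
    have h := mt (exists_outerEmb_eq hl (by omega) i) hi
    exact hc0 i (by omega) (by omega)
  have hDd : D = fun j => cdiag fun i => (D j i i).re := by
    ext j s t
    rw [cdiag, diagonal_apply]
    split_ifs with hst
    · subst hst
      exact (Complex.conj_eq_iff_re.mp ((hD j).apply _ _)).symm
    · exact hblk j _ _ ((Fin.castLE_injective hl).ne hst) (Or.inl s.2)
  have hpoly : IsPolyhedral (jointCNumRangeR (cdiag (c ∘ outerEmb hl k)) D) := by
    rw [hDd]
    exact isPolyhedral_diag hĉ _
  have hblku : ∀ u, ∀ s t : Fin n, s ≠ t → ((s : ℕ) < l ∨ (t : ℕ) < l) →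
      (star U * comb A u * U) s t = 0 := by
    intro u s t hst h
    have : (star U * comb A u * U) s t = ∑ j, (u j : ℂ) * (star U * A j * U) s t := by
      simp [comb, Finset.mul_sum, Finset.sum_mul, Matrix.sum_apply]
    rw [this]
    exact Finset.sum_eq_zero fun j _ => by rw [hblk j s t hst h, mul_zero]
  have heq : jointCNumRangeR (cdiag c) A = jointCNumRangeR (cdiag (c ∘ outerEmb hl k)) D := by
    refine Set.Subset.antisymm (fun p hp => hpoly.mem_of_forall fun u => ?_)
      (jointCNumRangeR_submatrix_subset (Fin.castLE_injective hl)
        (outerEmb_strictMono hl k).injective hcr A hU)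
    obtain ⟨X, hX, rfl⟩ := (mem_jointCNumRangeR_cdiag hA _ _).mp hp
    obtain ⟨lam, mu, hlam, hmu, ⟨W, hWu, hlamW⟩, ⟨V, hV, hmuV⟩, e, he, hme⟩ :=
      exists_subfamily_eigenvalues hl (comb_isHermitian hA u) hU (hblku u)
    have htop := eq_of_ind_dotProduct_le hmu hlam he hme hl (by omega)
      (ind_dotProduct_le_of_range_subset hl hA hW hmu ⟨W, hWu, hlamW⟩ ⟨V, hV, hmuV⟩)
    have hbot := eq_of_ind_dotProduct_le (k := k) (neg_comp_rev_antitone hmu)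
      (neg_comp_rev_antitone hlam) (e := Fin.rev ∘ e ∘ Fin.rev)
      (Fin.rev_injective.comp (he.comp Fin.rev_injective)) (by ext i; simp [hme]) hl (by omega)
      (ind_dotProduct_le_of_range_subset (u := -u) hl hA hW (neg_comp_rev_antitone hmu)
        (by rw [comb_neg]; exact unitary_diag_neg_rev hWu hlamW)
        (by
          rw [comb_neg, mul_neg, neg_mul]
          exact unitary_diag_neg_rev hV hmuV))
    refine ⟨_, (mem_jointCNumRangeR_cdiag hD _ _).mpr ⟨V, hV, rfl⟩, ?_⟩
    rw [← cval_comb, ← cval_comb, comb_submatrix, cval_eigen _ hV hmuV]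
    refine (cval_le hc hlam hWu hlamW hX).trans_eq ?_
    refine (Fintype.sum_of_injective (outerEmb hl k) (outerEmb_strictMono hl k).injective _ _
      (fun i hi => by rw [hcr i hi, mul_zero]) fun i => ?_).symm
    by_cases hik : (i : ℕ) < k
    · rw [htop i (outerEmb hl k i) (by rw [outerEmb_val, if_pos hik]) hik]
      rfl
    by_cases hil : l ≤ i + k
    · have h := hbot i.rev (outerEmb hl k i).rev
        (by simp only [Fin.val_rev, outerEmb_val, if_neg hik]; omega)
        (by simp only [Fin.val_rev]; omega)
      simp only [Pi.neg_apply, Function.comp, Fin.rev_rev, neg_inj] at h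
      rw [h]
      rfl
    · have : c (outerEmb hl k i) = 0 := by
        refine hc0 _ ?_ ?_ <;> rw [outerEmb_val, if_neg hik] <;> omega
      simp [this]
  exact ⟨heq, heq ▸ hpoly⟩

end BlockRange

section PolyhedralToBlock

open scoped ComplexOrder

variable {n m k l : ℕ} {A : Fin m → Matrix (Fin n) (Fin n) ℂ}

lemma exists_coordinate_isometry (hl : l ≤ n) :
    ∃ J : Matrix (Fin n) (Fin l) ℂ, J * Jᴴ = cdiag (ind n l) ∧
      ∀ B : Matrix (Fin n) (Fin n) ℂ,
        B.submatrix (Fin.castLE hl) (Fin.castLE hl) = Jᴴ * B * J := by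
  refine ⟨(1 : Matrix (Fin n) (Fin n) ℂ).submatrix id (Fin.castLE hl), ?_, fun B => ?_⟩
  · ext s t
    simp only [cdiag, mul_apply, conjTranspose_apply, submatrix_apply, one_apply, diagonal_apply,
      id, ind]
    by_cases hs : (s : ℕ) < l
    · rw [Finset.sum_eq_single ⟨s, hs⟩]
      · by_cases hst : s = t
        · subst hst
          simp [hs]
        · simp [hst, Ne.symm hst]
      · intro b _ hb
        have : s ≠ Fin.castLE hl b := fun h => hb (Fin.ext (congrArg Fin.val h).symm)
        simp [this]
      · simp
    · rw [Finset.sum_eq_zero]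
      · simp [hs]
      · intro b _
        have : s ≠ Fin.castLE hl b := fun h => hs (by rw [h]; exact b.2)
        simp [this]
  · ext s t
    simp [mul_apply, one_apply]

lemma sum_ind {r : ℕ} (hr : r ≤ n) : ∑ i, ind n r i = r := by
  have h : ∑ i, ind n r i = ∑ _i : Fin r, (1 : ℝ) := by
    refine (Fintype.sum_of_injective (Fin.castLE hr) (Fin.castLE_injective hr) _ _ ?_ ?_).symm
    · intro a ha
      have : ¬ (a : ℕ) < r := fun h => ha ⟨⟨a, h⟩, rfl⟩
      simp [ind, this]
    · intro a
      simp [ind]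
  simp [h]

/-- A point of the `k`-numerical range whose projector lies under the block projector is attained
on the block. -/
lemma cpoint_mem_block (hl : l ≤ n) (hkl : k ≤ l) (hA : ∀ j, (A j).IsHermitian)
    {U V : Matrix (Fin n) (Fin n) ℂ} (hV : V ∈ unitaryGroup (Fin n) ℂ)
    (hUV : proj l U * proj k V = proj k V) :
    cpoint (ind n k) A V ∈ jointCNumRangeR (cdiag (ind l k))
      (fun j => (star U * A j * U).submatrix (Fin.castLE hl) (Fin.castLE hl)) := by
  obtain ⟨J, hJ, hJs⟩ := exists_coordinate_isometry hl
  set P := proj k V with hP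
  set R := proj l U with hR
  let K := U * J
  have hK : K * Kᴴ = R := by
    rw [conjTranspose_mul, hR, proj, dconj, ← hJ]
    simp only [K, Matrix.mul_assoc]
    rfl
  have hPh : P.IsHermitian := proj_isHermitian k V
  have hPR : P * R = P := by
    have := congrArg conjTranspose hUV
    rwa [conjTranspose_mul, hPh.eq, (proj_isHermitian l U).eq] at this
  have hPP : P * P = P := proj_mul_self k hV
  have hD : ∀ j, (star U * A j * U).submatrix (Fin.castLE hl) (Fin.castLE hl) =
      Kᴴ * A j * K := fun j => by
    rw [hJs, conjTranspose_mul]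
    simp only [K, Matrix.mul_assoc]
    rfl
  have hDh : ∀ j, ((star U * A j * U).submatrix (Fin.castLE hl) (Fin.castLE hl)).IsHermitian :=
    fun j => (star_mul_mul_isHermitian (hA j) U).submatrix _
  have hQh : (Kᴴ * P * K).IsHermitian := isHermitian_conjTranspose_mul_mul K hPh
  obtain ⟨X, hX, hQX⟩ := exists_unitary_eigDesc hQh
  have hQQ : (Kᴴ * P * K) * (Kᴴ * P * K) = Kᴴ * P * K := by
    calc _ = Kᴴ * (P * (K * Kᴴ) * P) * K := by simp only [Matrix.mul_assoc]
      _ = _ := by rw [hK, hPR, hPP]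
  obtain ⟨r, hr, hQr⟩ := exists_eq_ind (eigDesc_antitone (Kᴴ * P * K)) <|
    dconj_injective hX <| by
      rw [← dconj_mul hX, dconj, ← hQX, hQQ]
  rw [hQr] at hQX
  have htr : (Kᴴ * P * K).trace = P.trace := by
    rw [Matrix.mul_assoc, trace_mul_comm, Matrix.mul_assoc, hK, hPR]
  have hrk : r = k := by
    rw [hQX, ← dconj, trace_dconj hX, hP, proj, trace_dconj hV, sum_ind hr,
      sum_ind (hkl.trans hl)] at htr
    exact_mod_cast htr
  subst hrk
  refine (mem_jointCNumRangeR_cdiag hDh _ _).mpr ⟨X, hX, funext fun j => ?_⟩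
  rw [cpoint, cpoint, cval_eq_trace, cval_eq_trace, ← hQX, hD]
  congr 1
  symm
  calc (Kᴴ * A j * K * (Kᴴ * P * K)).trace = (Kᴴ * (A j * (K * Kᴴ) * P * K)).trace := by
        simp only [Matrix.mul_assoc]
    _ = (A j * (R * (P * R))).trace := by
        rw [trace_mul_comm, hK, ← hK]
        simp only [Matrix.mul_assoc]
    _ = (A j * P).trace := by rw [hPR, hUV]

/-- A tuple with a polyhedral `C`-numerical range splits off a diagonal block of size at least
`2 γ(C)` carrying the whole `γ(C)`-numerical range. -/
lemma exists_block_of_isPolyhedral (hA : ∀ j, (A j).IsHermitian) (hk1 : 1 ≤ k) (hk2 : 2 * k ≤ n)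
    {c : Fin n → ℝ} (hc : Antitone c) (hck : c ⟨k, by omega⟩ < c ⟨k - 1, by omega⟩)
    (hpoly : IsPolyhedral (convexHull ℝ (jointCNumRangeR (cdiag c) A))) :
    ∃ (l : ℕ) (hl : l ≤ n), 2 * k ≤ l ∧ ∃ U ∈ unitaryGroup (Fin n) ℂ,
      (∀ j, ∀ s t : Fin n, s ≠ t → ((s : ℕ) < l ∨ (t : ℕ) < l) →
        (star U * A j * U) s t = 0) ∧
      jointCNumRangeR (cdiag (ind n k)) A ⊆ jointCNumRangeR (cdiag (ind l k))
        (fun j => (star U * A j * U).submatrix (Fin.castLE hl) (Fin.castLE hl)) := by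
  obtain ⟨E, V, hE, hcov, hexp⟩ := exists_maximizer_family hA c hpoly
  have : Finite E := hE
  have hind : ∀ u p, IsMaximizer c (comb A u) (V p) → IsMaximizer (ind n k) (comb A u) (V p) :=
    fun u p h => h.ind (comb_isHermitian hA u) hc hk1 (by omega) hck
  have hcov' : ∀ u, ∃ p, IsMaximizer (ind n k) (comb A u) (V p) :=
    fun u => (hcov u).imp fun p h => hind u p h
  obtain ⟨R, hR, hRR, hrank, hRP, hAR, hcomm⟩ := exists_commuting_projector hA hk1 hk2 hcov'
    fun p => (hexp p).imp fun u₀ h w => (h w).imp fun ε hε => ⟨hε.1, hind _ p hε.2⟩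
  obtain ⟨U, hU, hRU, hblk⟩ := exists_unitary_block hA hR hRR hAR hcomm
  have hl : R.rank ≤ n := R.rank_le_width
  refine ⟨R.rank, hl, hrank, U, hU, hblk, fun p hp => ?_⟩
  obtain ⟨X, hX, rfl⟩ := (mem_jointCNumRangeR_cdiag hA _ _).mp hp
  have hDd : (fun j => (star U * A j * U).submatrix (Fin.castLE hl) (Fin.castLE hl)) =
      fun j => cdiag fun i => ((star U * A j * U) (Fin.castLE hl i) (Fin.castLE hl i)).re := by
    ext j s t
    rw [cdiag, diagonal_apply, submatrix_apply]
    split_ifs with hst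
    · subst hst
      exact (Complex.conj_eq_iff_re.mp ((star_mul_mul_isHermitian (hA j) U).apply _ _)).symm
    · exact hblk j _ _ ((Fin.castLE_injective hl).ne hst) (Or.inl s.2)
  have hpolyD : IsPolyhedral (jointCNumRangeR (cdiag (ind R.rank k))
      (fun j => (star U * A j * U).submatrix (Fin.castLE hl) (Fin.castLE hl))) := by
    rw [hDd]
    exact isPolyhedral_diag (ind_antitone _ _) _
  refine hpolyD.mem_of_forall fun u => ?_
  obtain ⟨q, hq⟩ := hcov' u
  refine ⟨cpoint (ind n k) A (V q), cpoint_mem_block hl (by omega) hA hq.1 ?_, ?_⟩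
  · rw [← hRU, hRP]
  · rw [← cval_comb, ← cval_comb]
    exact hq.2 X hX

end PolyhedralToBlock

section Weights

open scoped ComplexOrder

variable {n m k l : ℕ}

lemma eigDesc_cdiag {c : Fin n → ℝ} (hc : Antitone c) : eigDesc (cdiag c) = c := by
  obtain ⟨W, hW, h⟩ := exists_unitary_eigDesc (cdiag_isHermitian c)
  have h1 : cdiag c = 1 * cdiag c * star (1 : Matrix (Fin n) (Fin n) ℂ) := by simp
  refine eq_of_ind_dotProduct_eq fun r _ => ?_
  rw [dotProduct_comm, dotProduct_comm _ c]
  refine le_antisymm ?_ ?_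
  · rw [← cval_eigen _ hW h]
    exact cval_le (ind_antitone n r) hc (one_mem _) h1 hW
  · rw [← cval_eigen _ (one_mem _) h1]
    exact cval_le (ind_antitone n r) (eigDesc_antitone _) hW h (one_mem _)

lemma gammaC_ind (hk1 : 1 ≤ k) (hk2 : 2 * k ≤ n) : gammaC (cdiag (ind n k)) = k := by
  rw [gammaC, eigDesc_cdiag (ind_antitone n k)]
  refine (congrArg sSup (Set.ext fun t => ?_)).trans (csSup_singleton k)
  rw [Set.mem_singleton_iff]
  constructor
  · rintro ⟨j, h1, h2, h3, h4⟩
    have : j - 1 < k ∧ ¬ j < k := by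
      simp only [ind] at h3
      split_ifs at h3 <;> first | omega | norm_num at h3
    omega
  · rintro rfl
    refine ⟨t, hk1, by omega, ?_, Or.inl ⟨rfl, hk2⟩⟩
    have : t - 1 < t := by omega
    simp [ind, this]

lemma eigDesc_eq_of_gammaC_le {C : Matrix (Fin n) (Fin n) ℂ} (hC : gammaC C ≤ k)
    (hkn : k < n) (i : Fin n) (hki : k ≤ i) (hik : (i : ℕ) + k < n) :
    eigDesc C i = eigDesc C ⟨k, hkn⟩ := by
  obtain ⟨i, hi⟩ := i
  simp only at hki hik
  induction i, hki using Nat.le_induction with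
  | base => rfl
  | succ j hkj ih =>
    rw [← ih (by omega) (by omega)]
    by_contra hne
    have hlt : eigDesc C ⟨j + 1, hi⟩ < eigDesc C ⟨j, by omega⟩ :=
      lt_of_le_of_ne (eigDesc_antitone C (Fin.mk_le_mk.mpr (Nat.le_succ j))) hne
    by_cases h2 : 2 * (j + 1) ≤ n
    · have := le_csSup (gammaC_bddAbove C)
        ⟨j + 1, by omega, hi, hlt, Or.inl ⟨rfl, h2⟩⟩
      rw [gammaC] at hC
      omega
    · have := le_csSup (gammaC_bddAbove C)
        ⟨j + 1, by omega, hi, hlt, Or.inr ⟨rfl, by omega⟩⟩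
      rw [gammaC] at hC
      omega

lemma jointKNumRangeR_eq (k : ℕ) (A : Fin m → Matrix (Fin n) (Fin n) ℂ) :
    jointKNumRangeR k A = jointCNumRangeR (cdiag (ind n k)) A := by
  rw [jointKNumRangeR, cdiag]
  congr
  ext i
  simp only [ind]
  split_ifs <;> simp

lemma jointCNumRangeR_sub_smul_one {C : Matrix (Fin n) (Fin n) ℂ} (hC : C.IsHermitian)
    (A : Fin m → Matrix (Fin n) (Fin n) ℂ) (t : ℝ) :
    jointCNumRangeR (C - (t : ℂ) • (1 : Matrix (Fin n) (Fin n) ℂ)) A =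
      jointCNumRangeR (cdiag (eigDesc C - fun _ => t)) A := by
  obtain ⟨U, hU, h⟩ := exists_unitary_eigDesc hC
  have : C - (t : ℂ) • (1 : Matrix (Fin n) (Fin n) ℂ) =
      U * cdiag (eigDesc C - fun _ => t) * star U := by
    rw [← dconj, dconj_sub, dconj_const hU, dconj, ← h]
  rw [this, jointCNumRangeR_conj _ _ hU]

open scoped Pointwise in
lemma isPolyhedral_of_sub_smul_one {C : Matrix (Fin n) (Fin n) ℂ}
    {A : Fin m → Matrix (Fin n) (Fin n) ℂ} (hA : ∀ j, (A j).IsHermitian) (t : ℝ)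
    (h : IsPolyhedral (jointCNumRangeR (C - (t : ℂ) • (1 : Matrix (Fin n) (Fin n) ℂ)) A)) :
    IsPolyhedral (jointCNumRangeR C A) := by
  obtain ⟨F, hF, hS⟩ := h
  let v : Fin m → ℝ := fun j => t * (A j).trace.re
  refine ⟨v +ᵥ F, hF.vadd_set, ?_⟩
  rw [convexHull_vadd, ← hS]
  have htr : ∀ j, (((A j).trace.re : ℝ) : ℂ) = (A j).trace := fun j => by
    refine Complex.conj_eq_iff_re.mp ?_
    have := trace_conjTranspose (A j)
    rw [(hA j).eq] at this
    exact this.symm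
  ext p
  rw [Set.mem_vadd_set_iff_neg_vadd_mem]
  refine exists_congr fun U => and_congr_right fun hU => forall_congr' fun j => ?_
  have hU' : (star U * A j * U).trace = (A j).trace := by
    rw [trace_mul_comm, ← mul_assoc, mul_star_self_of_mem hU, one_mul]
  simp only [sub_mul, trace_sub, smul_mul_assoc, one_mul, trace_smul, hU', vadd_eq_add,
    Pi.add_apply, Pi.neg_apply, v, smul_eq_mul, Complex.ofReal_add, Complex.ofReal_neg,
    Complex.ofReal_mul, htr]
  rw [neg_add_eq_sub, sub_left_inj]

lemma ind_comp_outerEmb (hl : l ≤ n) : ind n k ∘ outerEmb hl k = ind l k := by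
  ext i
  simp only [Function.comp, ind, outerEmb_val]
  split_ifs <;> first | rfl | omega

end Weights

theorem stmt_16 {n m : ℕ} (hm : 0 < m)
    (A : Fin m → Matrix (Fin n) (Fin n) ℂ) (hA : ∀ j, (A j).IsHermitian)
    (k : ℕ) (hk1 : 1 ≤ k) (hk2 : 2 * k ≤ n) :
    List.TFAE
      [ -- (a)
        (∃ C : Matrix (Fin n) (Fin n) ℂ, C.IsHermitian ∧ gammaC C = k ∧
          (IsPolyhedral (convexHull ℝ (jointCNumRangeR C A)) ∨
            IsPolyhedral (jointCNumRangeR C A))),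
        -- (b)
        (∃ (ℓ : ℕ) (hℓ : ℓ ≤ n), 2 * k ≤ ℓ ∧
          ∃ U ∈ Matrix.unitaryGroup (Fin n) ℂ,
            (∀ j, ∀ s t : Fin n, s ≠ t → ((s : ℕ) < ℓ ∨ (t : ℕ) < ℓ) →
              (star U * A j * U) s t = 0) ∧
            jointKNumRangeR k A = jointKNumRangeR k
              (fun j => (star U * A j * U).submatrix (Fin.castLE hℓ) (Fin.castLE hℓ))),
        -- (c)
        (∃ (ℓ : ℕ) (hℓ : ℓ ≤ n), 2 * k ≤ ℓ ∧
          ∃ U ∈ Matrix.unitaryGroup (Fin n) ℂ,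
            (∀ j, ∀ s t : Fin n, s ≠ t → ((s : ℕ) < ℓ ∨ (t : ℕ) < ℓ) →
              (star U * A j * U) s t = 0) ∧
            ∀ C : Matrix (Fin n) (Fin n) ℂ, C.IsHermitian → gammaC C = k →
              jointCNumRangeR
                  (C - ((eigDesc C ⟨k, by omega⟩ : ℝ) : ℂ) • (1 : Matrix (Fin n) (Fin n) ℂ)) A
                = jointCNumRangeR
                    (Matrix.diagonal (fun i : Fin ℓ =>
                      if h : (i : ℕ) < k then
                        ((eigDesc C ⟨i, by omega⟩ - eigDesc C ⟨k, by omega⟩ : ℝ) : ℂ)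
                      else
                        ((eigDesc C ⟨(i : ℕ) + n - ℓ, by have := i.isLt; omega⟩
                          - eigDesc C ⟨k, by omega⟩ : ℝ) : ℂ)))
                    (fun j => (star U * A j * U).submatrix (Fin.castLE hℓ) (Fin.castLE hℓ))),
        -- (d)
        (∀ C : Matrix (Fin n) (Fin n) ℂ, C.IsHermitian → gammaC C ≤ k →
          IsPolyhedral (jointCNumRangeR C A)) ] := by
  have hkn : k < n := by omega
  have hshift : ∀ C : Matrix (Fin n) (Fin n) ℂ, gammaC C ≤ k →
      Antitone (eigDesc C - fun _ => eigDesc C ⟨k, hkn⟩) ∧ ∀ i : Fin n, k ≤ i →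
        (i : ℕ) + k < n → (eigDesc C - (fun _ => eigDesc C ⟨k, hkn⟩ : Fin n → ℝ)) i = 0 := fun C hC =>
    ⟨fun s t hst => sub_le_sub_right (eigDesc_antitone C hst) _, fun i hki hik =>
      sub_eq_zero.mpr (eigDesc_eq_of_gammaC_le hC hkn i hki hik)⟩
  tfae_have 1 → 2 := by
    rintro ⟨C, hC, hCk, hpoly⟩
    have hpoly' : IsPolyhedral (convexHull ℝ (jointCNumRangeR C A)) :=
      hpoly.elim id fun h => by rwa [h.convex.convexHull_eq]
    obtain ⟨c, hc, hck, hcp⟩ := exists_antitone_gap hC hk1 hkn hCk hpoly'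
    obtain ⟨l, hl, hkl, U, hU, hblk, hW⟩ := exists_block_of_isPolyhedral hA hk1 hk2 hc hck hcp
    refine ⟨l, hl, hkl, U, hU, hblk, ?_⟩
    rw [jointKNumRangeR_eq, jointKNumRangeR_eq, ← ind_comp_outerEmb hl]
    exact (jointCNumRangeR_eq_block hl hkl hA hU hblk hW (ind_antitone n k)
      fun i hi _ => if_neg (not_lt.mpr hi)).1
  tfae_have 2 → 3 := by
    rintro ⟨l, hl, hkl, U, hU, hblk, hW⟩
    refine ⟨l, hl, hkl, U, hU, hblk, fun C hC hCk => ?_⟩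
    rw [jointKNumRangeR_eq, jointKNumRangeR_eq] at hW
    obtain ⟨hc, hc0⟩ := hshift C hCk.le
    rw [jointCNumRangeR_sub_smul_one hC,
      (jointCNumRangeR_eq_block hl hkl hA hU hblk hW.subset hc hc0).1, cdiag]
    congr 2
    ext i
    simp only [Function.comp, outerEmb]
    split_ifs <;> rfl
  tfae_have 3 → 2 := by
    rintro ⟨l, hl, hkl, U, hU, hblk, hW⟩
    refine ⟨l, hl, hkl, U, hU, hblk, ?_⟩
    have h := hW _ (cdiag_isHermitian (ind n k)) (gammaC_ind hk1 hk2)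
    have hk0 : ind n k ⟨k, hkn⟩ = 0 := if_neg (lt_irrefl k)
    rw [eigDesc_cdiag (ind_antitone n k), hk0, Complex.ofReal_zero, zero_smul, sub_zero] at h
    rw [jointKNumRangeR_eq, jointKNumRangeR_eq, h, cdiag, ← ind_comp_outerEmb hl]
    congr 2
    ext i
    simp only [Function.comp, outerEmb]
    split_ifs <;> rw [hk0, sub_zero]
  tfae_have 2 → 4 := by
    rintro ⟨l, hl, hkl, U, hU, hblk, hW⟩ C hC hCk
    rw [jointKNumRangeR_eq, jointKNumRangeR_eq] at hW
    obtain ⟨hc, hc0⟩ := hshift C hCk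
    refine isPolyhedral_of_sub_smul_one hA (eigDesc C ⟨k, hkn⟩) ?_
    rw [jointCNumRangeR_sub_smul_one hC]
    exact (jointCNumRangeR_eq_block hl hkl hA hU hblk hW.subset hc hc0).2
  tfae_have 4 → 1 := fun h =>
    ⟨_, cdiag_isHermitian (ind n k), gammaC_ind hk1 hk2,
      Or.inr (h _ (cdiag_isHermitian _) (gammaC_ind hk1 hk2).le)⟩
  tfae_finish
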